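/- Let N ≥ 5 be an integer and p > 1 a real number. Let H(x) = x⁴ − (32p(p+1)/(p−1)²)x² + (32p(p+1)(p+3)/(p−1)³)x − 64p(p+1)²/(p−1)⁴, and let x₀ be the largest real root of H (i.e. H(x₀) = 0 and H(x) ≠ 0 for all x > x₀). If N < 2 + 2x₀, then there exists no classical stable solution of Δ²u = u^p, u > 0, in ℝ^N; that is, there is no function u ∈ C⁴(ℝ^N) with u > 0 everywhere, Δ(Δu) = u^p, and ∫_{ℝ^N} |Δφ|² dx ≥ p ∫_{ℝ^N} u^{p−1} φ² dx for every φ ∈ C_c^∞(ℝ^N). -/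

import Mathlib

open MeasureTheory Real

/-- The Laplacian of a function on `ℝ^N` (sum of pure second derivatives). -/
noncomputable def lap {N : ℕ} (u : EuclideanSpace ℝ (Fin N) → ℝ)
    (x : EuclideanSpace ℝ (Fin N)) : ℝ :=
  ∑ i : Fin N, fderiv ℝ (fun y => fderiv ℝ u y (EuclideanSpace.single i 1)) x
    (EuclideanSpace.single i 1)
/-- The quartic polynomial `H` from Theorem 1.1. -/
noncomputable def Hpoly (p x : ℝ) : ℝ :=
  x ^ 4 - 32 * p * (p + 1) / (p - 1) ^ 2 * x ^ 2
    + 32 * p * (p + 1) * (p + 3) / (p - 1) ^ 3 * x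
    - 64 * p * (p + 1) ^ 2 / (p - 1) ^ 4

section Calculus

variable {N : ℕ}

/-- The partial derivative of `f` in the `i`-th coordinate direction. -/
noncomputable def pd (i : Fin N) (f : EuclideanSpace ℝ (Fin N) → ℝ)
    (x : EuclideanSpace ℝ (Fin N)) : ℝ :=
  fderiv ℝ f x (EuclideanSpace.single i 1)

/-- The inner product of the gradients of `f` and `g`. -/
noncomputable def gradDot (f g : EuclideanSpace ℝ (Fin N) → ℝ)
    (x : EuclideanSpace ℝ (Fin N)) : ℝ :=
  ∑ i : Fin N, pd i f x * pd i g x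

variable {f g h : EuclideanSpace ℝ (Fin N) → ℝ} {x : EuclideanSpace ℝ (Fin N)} {i : Fin N}

lemma lap_eq_sum_pd : lap f x = ∑ i : Fin N, pd i (pd i f) x := rfl

lemma gradDot_comm : gradDot f g x = gradDot g f x := by
  simp only [gradDot, mul_comm]

lemma gradDot_self_nonneg : 0 ≤ gradDot f f x :=
  Finset.sum_nonneg fun _ _ => mul_self_nonneg _

lemma gradDot_sq_le : gradDot f g x ^ 2 ≤ gradDot f f x * gradDot g g x := by
  have := Finset.sum_mul_sq_le_sq_mul_sq Finset.univ (fun i => pd i f x) (fun i => pd i g x)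
  simpa only [gradDot, sq] using this

lemma contDiff_pd {m n : ℕ∞} (hf : ContDiff ℝ n f) (hmn : m + 1 ≤ n) (i : Fin N) :
    ContDiff ℝ m (pd i f) := by
  have : ContDiff ℝ m (fderiv ℝ f) := hf.fderiv_right (by exact_mod_cast hmn)
  exact this.clm_apply contDiff_const

lemma contDiff_lap {m n : ℕ∞} (hf : ContDiff ℝ n f) (hmn : m + 2 ≤ n) :
    ContDiff ℝ m (lap f) := by
  refine ContDiff.sum fun i _ => ?_
  exact contDiff_pd (m := m) (n := m + 1) (contDiff_pd hf (by rw [add_assoc]; exact hmn) i) le_rfl i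

lemma contDiff_gradDot {m n : ℕ∞} (hf : ContDiff ℝ n f) (hg : ContDiff ℝ n g) (hmn : m + 1 ≤ n) :
    ContDiff ℝ m (gradDot f g) :=
  ContDiff.sum fun i _ => (contDiff_pd hf hmn i).mul (contDiff_pd hg hmn i)

lemma continuous_pd (hf : ContDiff ℝ 1 f) (i : Fin N) : Continuous (pd i f) :=
  (contDiff_pd (m := 0) (n := 1) hf (by simp) i).continuous

lemma continuous_lap (hf : ContDiff ℝ 2 f) : Continuous (lap f) :=
  (contDiff_lap (m := 0) (n := 2) hf (by simp)).continuous

lemma continuous_gradDot (hf : ContDiff ℝ 1 f) (hg : ContDiff ℝ 1 g) :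
    Continuous (gradDot f g) :=
  (contDiff_gradDot (m := 0) (n := 1) hf hg (by simp)).continuous

lemma ContDiff.pd_one (hf : ContDiff ℝ 2 f) (i : Fin N) : ContDiff ℝ 1 (pd i f) :=
  contDiff_pd (m := 1) (n := 2) hf (by norm_num) i

lemma HasCompactSupport.pd (hf : HasCompactSupport f) (i : Fin N) :
    HasCompactSupport (pd i f) :=
  hf.fderiv_apply (𝕜 := ℝ) _

lemma tsupport_pd_subset (i : Fin N) : tsupport (pd i f) ⊆ tsupport f :=
  tsupport_fderiv_apply_subset ℝ _

lemma pd_mul (hf : DifferentiableAt ℝ f x) (hg : DifferentiableAt ℝ g x) :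
    pd i (fun y => f y * g y) x = pd i f x * g x + f x * pd i g x := by
  simp only [pd, fderiv_fun_mul hf hg]
  simp; ring

lemma pd_add (hf : DifferentiableAt ℝ f x) (hg : DifferentiableAt ℝ g x) :
    pd i (fun y => f y + g y) x = pd i f x + pd i g x := by
  simp [pd, fderiv_fun_add hf hg]

lemma pd_sub (hf : DifferentiableAt ℝ f x) (hg : DifferentiableAt ℝ g x) :
    pd i (fun y => f y - g y) x = pd i f x - pd i g x := by
  simp [pd, fderiv_fun_sub hf hg]

lemma pd_const_mul (c : ℝ) (hf : DifferentiableAt ℝ f x) :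
    pd i (fun y => c * f y) x = c * pd i f x := by
  simp [pd, fderiv_const_mul hf]

lemma pd_neg : pd i (fun y => - f y) x = - pd i f x := by
  simp [pd, fderiv_fun_neg]

lemma pd_comp {k : ℝ → ℝ} {k' : ℝ} (hk : HasDerivAt k k' (f x)) (hf : DifferentiableAt ℝ f x) :
    pd i (fun y => k (f y)) x = k' * pd i f x := by
  have := (hk.comp_hasFDerivAt x hf.hasFDerivAt).fderiv
  simp only [pd]
  change fderiv ℝ (k ∘ f) x _ = _
  rw [this]; simp

lemma pd_rpow (a : ℝ) (hf : DifferentiableAt ℝ f x) (h0 : 0 < f x) :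
    pd i (fun y => f y ^ a) x = a * f x ^ (a - 1) * pd i f x :=
  pd_comp (k := fun t => t ^ a) (Real.hasDerivAt_rpow_const (Or.inl h0.ne')) hf

lemma pd_pow (n : ℕ) (hf : DifferentiableAt ℝ f x) :
    pd i (fun y => f y ^ n) x = n * f x ^ (n - 1) * pd i f x :=
  pd_comp (k := fun t => t ^ n) (hasDerivAt_pow n (f x)) hf

lemma Filter.EventuallyEq.pd_eq (hfg : f =ᶠ[nhds x] g) : pd i f x = pd i g x := by
  simp only [pd, hfg.fderiv_eq]

lemma lap_mul (hf : ContDiff ℝ 2 f) (hg : ContDiff ℝ 2 g) :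
    lap (fun y => f y * g y) x = f x * lap g x + 2 * gradDot f g x + g x * lap f x := by
  have h1 : ∀ i, pd i (fun y => f y * g y) = fun y => pd i f y * g y + f y * pd i g y := by
    intro i; ext y
    exact pd_mul (hf.differentiable (by norm_num) y) (hg.differentiable (by norm_num) y)
  have d1 := fun y => hf.differentiable (by norm_num) y
  have d2 := fun y => hg.differentiable (by norm_num) y
  have d3 := fun i y => (hf.pd_one i).differentiable (by norm_num) y
  have d4 := fun i y => (hg.pd_one i).differentiable (by norm_num) y
  simp only [lap_eq_sum_pd, gradDot, h1, Finset.mul_sum, ← Finset.sum_add_distrib]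
  refine Finset.sum_congr rfl fun i _ => ?_
  rw [pd_add ((d3 i x).fun_mul (d2 x)) ((d1 x).fun_mul (d4 i x)), pd_mul (d3 i x) (d2 x),
    pd_mul (d1 x) (d4 i x)]
  ring

lemma lap_sub (hf : ContDiff ℝ 2 f) (hg : ContDiff ℝ 2 g) :
    lap (fun y => f y - g y) x = lap f x - lap g x := by
  have h1 : ∀ i, pd i (fun y => f y - g y) = fun y => pd i f y - pd i g y := by
    intro i; ext y
    exact pd_sub (hf.differentiable (by norm_num) y) (hg.differentiable (by norm_num) y)
  simp only [lap_eq_sum_pd, h1, ← Finset.sum_sub_distrib]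
  exact Finset.sum_congr rfl fun i _ => pd_sub ((hf.pd_one i).differentiable (by norm_num) x)
    ((hg.pd_one i).differentiable (by norm_num) x)

lemma lap_neg : lap (fun y => - f y) x = - lap f x := by
  have h1 : ∀ i, pd i (fun y => - f y) = fun y => - pd i f y := by
    intro i; ext y; exact pd_neg
  simp only [lap_eq_sum_pd, h1, pd_neg, Finset.sum_neg_distrib]

lemma lap_const_mul (c : ℝ) (hf : ContDiff ℝ 2 f) :
    lap (fun y => c * f y) x = c * lap f x := by
  have h1 : ∀ i, pd i (fun y => c * f y) = fun y => c * pd i f y := by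
    intro i; ext y; exact pd_const_mul c (hf.differentiable (by norm_num) y)
  simp only [lap_eq_sum_pd, h1, Finset.mul_sum]
  exact Finset.sum_congr rfl fun i _ => pd_const_mul c
    ((hf.pd_one i).differentiable (by norm_num) x)

lemma lap_rpow (a : ℝ) (hf : ContDiff ℝ 2 f) (h0 : 0 < f x) :
    lap (fun y => f y ^ a) x =
      a * f x ^ (a - 1) * lap f x + a * (a - 1) * f x ^ (a - 2) * gradDot f f x := by
  have hpos : ∀ᶠ y in nhds x, 0 < f y := hf.continuous.continuousAt.eventually (eventually_gt_nhds h0)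
  have d1 := fun y => hf.differentiable (by norm_num) y
  have d3 := fun i y => (hf.pd_one i).differentiable (by norm_num) y
  simp only [lap_eq_sum_pd, gradDot, Finset.mul_sum, ← Finset.sum_add_distrib]
  refine Finset.sum_congr rfl fun i _ => ?_
  have h1 : pd i (fun y => f y ^ a) =ᶠ[nhds x] fun y => a * (f y ^ (a - 1) * pd i f y) := by
    filter_upwards [hpos] with y hy
    rw [pd_rpow a (d1 y) hy]; ring
  have d5 : DifferentiableAt ℝ (fun y => f y ^ (a - 1)) x :=
    (d1 x).rpow_const (Or.inl h0.ne')
  rw [h1.pd_eq, pd_const_mul _ (d5.fun_mul (d3 i x)), pd_mul d5 (d3 i x), pd_rpow _ (d1 x) h0]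
  rw [show a - 1 - 1 = a - 2 by ring]; ring

lemma lap_pow (n : ℕ) (hf : ContDiff ℝ 2 f) :
    lap (fun y => f y ^ n) x =
      n * f x ^ (n - 1) * lap f x + n * (n - 1 : ℕ) * f x ^ (n - 2) * gradDot f f x := by
  have d1 := fun y => hf.differentiable (by norm_num) y
  have d3 := fun i y => (hf.pd_one i).differentiable (by norm_num) y
  simp only [lap_eq_sum_pd, gradDot, Finset.mul_sum, ← Finset.sum_add_distrib]
  refine Finset.sum_congr rfl fun i _ => ?_
  have h1 : pd i (fun y => f y ^ n) = fun y => n * (f y ^ (n - 1) * pd i f y) := by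
    ext y
    rw [pd_pow n (d1 y)]; ring
  have d5 : DifferentiableAt ℝ (fun y => f y ^ (n - 1)) x := (d1 x).pow _
  rw [h1, pd_const_mul _ (d5.fun_mul (d3 i x)), pd_mul d5 (d3 i x), pd_pow _ (d1 x)]
  rw [show n - 1 - 1 = n - 2 by omega]; ring

lemma gradDot_mul_left (hf : DifferentiableAt ℝ f x) (hg : DifferentiableAt ℝ g x) :
    gradDot (fun y => f y * g y) h x = f x * gradDot g h x + g x * gradDot f h x := by
  simp only [gradDot, Finset.mul_sum, ← Finset.sum_add_distrib, pd_mul hf hg]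
  exact Finset.sum_congr rfl fun i _ => by ring

lemma gradDot_mul_right (hf : DifferentiableAt ℝ f x) (hg : DifferentiableAt ℝ g x) :
    gradDot h (fun y => f y * g y) x = f x * gradDot h g x + g x * gradDot h f x := by
  rw [gradDot_comm, gradDot_mul_left hf hg, gradDot_comm, gradDot_comm (f := f)]

lemma gradDot_rpow_left (a : ℝ) (hf : DifferentiableAt ℝ f x) (h0 : 0 < f x) :
    gradDot (fun y => f y ^ a) h x = a * f x ^ (a - 1) * gradDot f h x := by
  simp only [gradDot, Finset.mul_sum, pd_rpow a hf h0, mul_assoc]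

lemma gradDot_rpow_right (a : ℝ) (hf : DifferentiableAt ℝ f x) (h0 : 0 < f x) :
    gradDot h (fun y => f y ^ a) x = a * f x ^ (a - 1) * gradDot h f x := by
  rw [gradDot_comm, gradDot_rpow_left a hf h0, gradDot_comm]

lemma gradDot_pow_left (n : ℕ) (hf : DifferentiableAt ℝ f x) :
    gradDot (fun y => f y ^ n) h x = n * f x ^ (n - 1) * gradDot f h x := by
  simp only [gradDot, Finset.mul_sum, pd_pow n hf, mul_assoc]

lemma gradDot_pow_right (n : ℕ) (hf : DifferentiableAt ℝ f x) :
    gradDot h (fun y => f y ^ n) x = n * f x ^ (n - 1) * gradDot h f x := by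
  rw [gradDot_comm, gradDot_pow_left n hf, gradDot_comm]

/-- The integral of a partial derivative of a compactly supported `C¹` function vanishes. -/
lemma integral_pd_eq_zero (hf : ContDiff ℝ 1 f) (hc : HasCompactSupport f) (i : Fin N) :
    ∫ x, pd i f x = 0 := by
  have h := integral_mul_fderiv_eq_neg_fderiv_mul_of_integrable (μ := volume)
    (f := fun _ : EuclideanSpace ℝ (Fin N) => (1 : ℝ)) (g := f) (v := EuclideanSpace.single i 1)
    (by simp) (by simpa [pd] using! (continuous_pd hf i).integrable_of_hasCompactSupport (hc.pd i))
    (by simpa using hf.continuous.integrable_of_hasCompactSupport hc)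
    (fun x _ => differentiableAt_const _) (fun x _ => hf.differentiable (by norm_num) x)
  simpa [pd] using h

lemma integral_mul_pd (hf : ContDiff ℝ 1 f) (hg : ContDiff ℝ 1 g) (hc : HasCompactSupport g)
    (i : Fin N) : ∫ x, f x * pd i g x = - ∫ x, pd i f x * g x := by
  have h0 := integral_pd_eq_zero (hf.mul hg) (hc.mul_left (f := f)) i
  have d1 := fun y => hf.differentiable (by norm_num) y
  have d2 := fun y => hg.differentiable (by norm_num) y
  have e : ∀ x, pd i (fun y => f y * g y) x = pd i f x * g x + f x * pd i g x :=
    fun x => pd_mul (d1 x) (d2 x)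
  simp only [e] at h0
  rw [integral_add] at h0
  · linarith
  · exact ((continuous_pd hf i).mul hg.continuous).integrable_of_hasCompactSupport
      (hc.mul_left)
  · exact (hf.continuous.mul (continuous_pd hg i)).integrable_of_hasCompactSupport
      ((hc.pd i).mul_left)

/-- Green's first identity, with the compact support on the second factor. -/
lemma integral_lap_mul (hf : ContDiff ℝ 2 f) (hg : ContDiff ℝ 1 g) (hc : HasCompactSupport g) :
    ∫ x, lap f x * g x = - ∫ x, gradDot f g x := by
  have e : ∀ i, ∫ x, pd i f x * pd i g x = - ∫ x, pd i (pd i f) x * g x :=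
    fun i => integral_mul_pd (hf.pd_one i) hg hc i
  simp only [lap_eq_sum_pd, gradDot, Finset.sum_mul]
  rw [integral_finsetSum, integral_finsetSum]
  · simp [e]
  · intro i _
    exact ((hf.pd_one i).continuous.mul (continuous_pd hg i)).integrable_of_hasCompactSupport
      ((hc.pd i).mul_left)
  · intro i _
    exact ((continuous_pd (hf.pd_one i) i).mul hg.continuous).integrable_of_hasCompactSupport
      (hc.mul_left)

/-- Green's first identity, with the compact support on the first factor. -/
lemma integral_mul_lap (hf : ContDiff ℝ 1 f) (hg : ContDiff ℝ 2 g) (hc : HasCompactSupport g) :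
    ∫ x, f x * lap g x = - ∫ x, gradDot f g x := by
  have e : ∀ i, ∫ x, f x * pd i (pd i g) x = - ∫ x, pd i f x * pd i g x :=
    fun i => integral_mul_pd hf (hg.pd_one i) (hc.pd i) i
  simp only [lap_eq_sum_pd, gradDot, Finset.mul_sum]
  rw [integral_finsetSum, integral_finsetSum]
  · simp [e]
  · intro i _
    exact ((continuous_pd hf i).mul (hg.pd_one i).continuous).integrable_of_hasCompactSupport
      ((hc.pd i).mul_left)
  · intro i _
    exact (hf.continuous.mul (continuous_pd (hg.pd_one i) i)).integrable_of_hasCompactSupport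
      (((hc.pd i).pd i).mul_left)

lemma integral_lap_mul_eq_mul_lap (hf : ContDiff ℝ 2 f) (hg : ContDiff ℝ 2 g)
    (hc : HasCompactSupport g) : ∫ x, lap f x * g x = ∫ x, f x * lap g x := by
  rw [integral_lap_mul hf (hg.of_le (by norm_num)) hc,
    integral_mul_lap (hf.of_le (by norm_num)) hg hc]

lemma HasCompactSupport.lap (hf : HasCompactSupport f) : HasCompactSupport (lap f) := by
  refine HasCompactSupport.intro hf.isCompact fun x hx => ?_
  refine Finset.sum_eq_zero fun i _ => ?_
  have := ((tsupport_pd_subset (f := _root_.pd i f) i).trans (tsupport_pd_subset (f := f) i))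
  exact image_eq_zero_of_notMem_tsupport (f := _root_.pd i (_root_.pd i f)) fun h => hx (this h)

lemma HasCompactSupport.gradDot_right (hg : HasCompactSupport g) :
    HasCompactSupport (gradDot f g) := by
  refine HasCompactSupport.intro hg.isCompact fun x hx => ?_
  refine Finset.sum_eq_zero fun i _ => ?_
  rw [image_eq_zero_of_notMem_tsupport fun h => hx (tsupport_pd_subset (f := g) i h), mul_zero]

end Calculus

section Mollification

open ContinuousLinearMap Filter Topology
open scoped Convolution

variable {N : ℕ}

lemma pd_convolution {ρ f : EuclideanSpace ℝ (Fin N) → ℝ} (hρ : Continuous ρ)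
    (hf : ContDiff ℝ 1 f) (hc : HasCompactSupport f) (i : Fin N) :
    pd i (ρ ⋆[lsmul ℝ ℝ, volume] f) = ρ ⋆[lsmul ℝ ℝ, volume] pd i f := by
  ext x
  have h := hc.hasFDerivAt_convolution_right (μ := volume) (lsmul ℝ ℝ)
    hρ.locallyIntegrable hf x
  rw [pd, h.fderiv]
  rw [convolution_precompR_apply (lsmul ℝ ℝ) hρ.locallyIntegrable (hc.fderiv ℝ)
    (hf.continuous_fderiv (by norm_num))]
  rfl

/-- Compactly supported `C²` functions are bounded pointwise limits of test functions, together
with their first derivatives and Laplacians. -/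
lemma exists_testFunction_approx {f : EuclideanSpace ℝ (Fin N) → ℝ} (hf : ContDiff ℝ 2 f)
    (hc : HasCompactSupport f) :
    ∃ (R M : ℝ) (F : ℕ → EuclideanSpace ℝ (Fin N) → ℝ),
      (∀ n, ContDiff ℝ (⊤ : ℕ∞) (F n)) ∧
      (∀ n x, x ∉ Metric.closedBall 0 R → F n x = 0) ∧
      (∀ n x, |F n x| ≤ M) ∧ (∀ x, Tendsto (fun n => F n x) atTop (𝓝 (f x))) ∧
      (∀ i n x, |pd i (F n) x| ≤ M) ∧
      (∀ i x, Tendsto (fun n => pd i (F n) x) atTop (𝓝 (pd i f x))) ∧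
      (∀ n x, |lap (F n) x| ≤ M) ∧
      (∀ x, Tendsto (fun n => lap (F n) x) atTop (𝓝 (lap f x))) := by
  let φ : ℕ → ContDiffBump (0 : EuclideanSpace ℝ (Fin N)) := fun n =>
    ⟨1 / (n + 2), 1 / (n + 1), by positivity, by
      apply one_div_lt_one_div_of_lt <;> [positivity; linarith]⟩
  have hφ : Tendsto (fun n => (φ n).rOut) atTop (𝓝 0) := tendsto_one_div_add_atTop_nhds_zero_nat
  have hφ1 : ∀ n, (φ n).rOut ≤ 1 := fun n => by
    change 1 / ((n : ℝ) + 1) ≤ 1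
    rw [div_le_one (by positivity)]; linarith [n.cast_nonneg (α := ℝ)]
  have hρc : ∀ n, Continuous ((φ n).normed volume) := fun n =>
    ((φ n).contDiff_normed (n := 0)).continuous
  let T : (EuclideanSpace ℝ (Fin N) → ℝ) → ℕ → EuclideanSpace ℝ (Fin N) → ℝ :=
    fun g n => (φ n).normed volume ⋆[lsmul ℝ ℝ, volume] g
  have hlim : ∀ g : EuclideanSpace ℝ (Fin N) → ℝ, Continuous g → ∀ x,
      Tendsto (fun n => T g n x) atTop (𝓝 (g x)) := fun g hg x =>
    ContDiffBump.convolution_tendsto_right_of_continuous hφ hg x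
  have hbd : ∀ g : EuclideanSpace ℝ (Fin N) → ℝ, Continuous g → HasCompactSupport g →
      ∃ M, ∀ n x, |T g n x| ≤ M := by
    intro g hg hgc
    obtain ⟨C, hC⟩ := hgc.exists_bound_of_continuous hg
    refine ⟨3 * C, fun n x => ?_⟩
    have h1 := (φ n).dist_normed_convolution_le (μ := volume) (x₀ := x) (g := g) (ε := 2 * C)
      hg.aestronglyMeasurable (fun y _ => by
        rw [dist_eq_norm]
        calc ‖g y - g x‖ ≤ ‖g y‖ + ‖g x‖ := norm_sub_le _ _
          _ ≤ 2 * C := by linarith [hC y, hC x])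
    have h2 := hC x
    rw [Real.dist_eq] at h1
    rw [Real.norm_eq_abs] at h2
    have := abs_add_le (T g n x - g x) (g x)
    rw [sub_add_cancel] at this
    change |T g n x - g x| ≤ _ at h1
    linarith
  have hf1 : ContDiff ℝ 1 f := hf.of_le (by norm_num)
  obtain ⟨R, hR⟩ := hc.isCompact.isBounded.subset_closedBall (0 : EuclideanSpace ℝ (Fin N))
  obtain ⟨M₀, hM₀⟩ := hbd f hf.continuous hc
  have hpdb := fun i => hbd (pd i f) (continuous_pd hf1 i) (hc.pd i)
  choose M₁ hM₁ using hpdb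
  have hpdpdb := fun i => hbd (pd i (pd i f)) (continuous_pd (hf.pd_one i) i) ((hc.pd i).pd i)
  choose M₂ hM₂ using hpdpdb
  have e1 : ∀ i n, pd i (T f n) = T (pd i f) n := fun i n => pd_convolution (hρc n) hf1 hc i
  have e2 : ∀ i n, pd i (pd i (T f n)) = T (pd i (pd i f)) n := fun i n => by
    rw [e1, pd_convolution (hρc n) (hf.pd_one i) (hc.pd i) i]
  have hM₁0 : ∀ i, 0 ≤ M₁ i := fun i => (abs_nonneg _).trans (hM₁ i 0 0)
  have hM₂0 : ∀ i, 0 ≤ M₂ i := fun i => (abs_nonneg _).trans (hM₂ i 0 0)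
  have hM₀0 : 0 ≤ M₀ := (abs_nonneg _).trans (hM₀ 0 0)
  have s1 : 0 ≤ ∑ i, M₁ i := Finset.sum_nonneg fun i _ => hM₁0 i
  have s2 : 0 ≤ ∑ i, M₂ i := Finset.sum_nonneg fun i _ => hM₂0 i
  refine ⟨R + 1, M₀ + ∑ i, M₁ i + ∑ i, M₂ i, T f, fun n => ?_, fun n x hx => ?_, fun n x => ?_,
    hlim f hf.continuous, fun i n x => ?_, fun i x => ?_, fun n x => ?_, fun x => ?_⟩
  · exact (φ n).hasCompactSupport_normed.contDiff_convolution_left _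
      ((φ n).contDiff_normed) hf.continuous.locallyIntegrable
  · have : T f n x = f x := by
      refine (φ n).normed_convolution_eq_right fun y hy => ?_
      have hx' : R + 1 < ‖x‖ := by simpa using hx
      have hy' : ‖y - x‖ < 1 := by
        rw [← dist_eq_norm]; exact (Metric.mem_ball.1 hy).trans_le (hφ1 n)
      have h0 : ∀ z, R < ‖z‖ → f z = 0 := fun z hz =>
        image_eq_zero_of_notMem_tsupport fun hz' => by
          have := hR hz'
          rw [mem_closedBall_zero_iff] at this
          linarith
      have := norm_sub_norm_le x y
      rw [norm_sub_rev] at this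
      rw [h0 y (by linarith), h0 x (by linarith)]
    rw [this]
    refine image_eq_zero_of_notMem_tsupport fun hz' => hx ?_
    exact Metric.closedBall_subset_closedBall (by linarith) (hR hz')
  · linarith [hM₀ n x]
  · rw [e1]
    have := Finset.single_le_sum (fun i _ => hM₁0 i) (Finset.mem_univ i)
    linarith [hM₁ i n x]
  · simp only [e1]; exact hlim _ (continuous_pd hf1 i) x
  · simp only [lap_eq_sum_pd, e2]
    have := (Finset.abs_sum_le_sum_abs (fun i => T (pd i (pd i f)) n x) Finset.univ).trans
      (Finset.sum_le_sum fun i _ => hM₂ i n x)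
    linarith
  · simp only [lap_eq_sum_pd, e2]
    exact tendsto_finsetSum _ fun i _ => hlim _ (continuous_pd (hf.pd_one i) i) x

/-- Weighted integrals of squares pass to bounded pointwise limits with uniformly bounded
supports. -/
lemma tendsto_integral_mul_sq {w g : EuclideanSpace ℝ (Fin N) → ℝ}
    {G : ℕ → EuclideanSpace ℝ (Fin N) → ℝ} {R M : ℝ} (hw : Continuous w)
    (hG : ∀ n, Continuous (G n)) (hs : ∀ n x, x ∉ Metric.closedBall 0 R → G n x = 0)
    (hb : ∀ n x, |G n x| ≤ M) (hl : ∀ x, Tendsto (fun n => G n x) atTop (𝓝 (g x))) :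
    Tendsto (fun n => ∫ x, w x * G n x ^ 2) atTop (𝓝 (∫ x, w x * g x ^ 2)) := by
  refine tendsto_integral_of_dominated_convergence
    (Set.indicator (Metric.closedBall 0 R) fun x => |w x| * M ^ 2)
    (fun n => (hw.mul ((hG n).pow 2)).aestronglyMeasurable) ?_ ?_ ?_
  · rw [integrable_indicator_iff Metric.isClosed_closedBall.measurableSet]
    exact (hw.abs.mul continuous_const).continuousOn.integrableOn_compact
      (isCompact_closedBall _ _)
  · refine fun n => ae_of_all _ fun x => ?_
    by_cases hx : x ∈ Metric.closedBall (0 : EuclideanSpace ℝ (Fin N)) R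
    · rw [Set.indicator_of_mem hx, norm_mul, norm_pow, Real.norm_eq_abs, Real.norm_eq_abs]
      gcongr
      exact hb n x
    · rw [Set.indicator_of_notMem hx, hs n x hx]; simp
  · exact ae_of_all _ fun x => tendsto_const_nhds.mul ((hl x).pow 2)

lemma eq_zero_off_of_tsupport {f : EuclideanSpace ℝ (Fin N) → ℝ} {R : ℝ}
    (h : ∀ x, x ∉ Metric.closedBall 0 R → f x = 0) :
    tsupport f ⊆ Metric.closedBall 0 R :=
  closure_minimal (fun x hx => by_contra fun hx' => hx (h x hx')) Metric.isClosed_closedBall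

/-- A second order stability inequality for test functions extends to `C²` functions of compact
support. -/
lemma stability_C2 {w : EuclideanSpace ℝ (Fin N) → ℝ} (hw : Continuous w)
    (hst : ∀ φ : EuclideanSpace ℝ (Fin N) → ℝ, ContDiff ℝ (⊤ : ℕ∞) φ → HasCompactSupport φ →
      ∫ x, w x * φ x ^ 2 ≤ ∫ x, (lap φ x) ^ 2)
    {f : EuclideanSpace ℝ (Fin N) → ℝ} (hf : ContDiff ℝ 2 f) (hc : HasCompactSupport f) :
    ∫ x, w x * f x ^ 2 ≤ ∫ x, (lap f x) ^ 2 := by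
  obtain ⟨R, M, F, hF, hs, hb, hl, -, -, hb2, hl2⟩ := exists_testFunction_approx hf hc
  have hcF : ∀ n, HasCompactSupport (F n) := fun n =>
    HasCompactSupport.intro (isCompact_closedBall 0 R) (hs n)
  have t1 := tendsto_integral_mul_sq hw (fun n => (hF n).continuous) hs hb hl
  have t2 := tendsto_integral_mul_sq (w := fun _ => 1) (R := R) continuous_const
    (fun n => continuous_lap (contDiff_infty.1 (hF n) 2))
    (fun n x hx => by
      refine Finset.sum_eq_zero fun i _ => ?_
      exact image_eq_zero_of_notMem_tsupport (f := pd i (pd i (F n))) fun h =>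
        hx (eq_zero_off_of_tsupport (hs n) (tsupport_pd_subset i (tsupport_pd_subset i h))))
    hb2 hl2
  simp only [one_mul] at t2
  exact le_of_tendsto_of_tendsto' t1 t2 fun n => hst _ (hF n) (hcF n)

/-- A first order stability inequality for test functions extends to `C²` functions of compact
support. -/
lemma first_order_C2 {w : EuclideanSpace ℝ (Fin N) → ℝ} (hw : Continuous w)
    (hst : ∀ φ : EuclideanSpace ℝ (Fin N) → ℝ, ContDiff ℝ (⊤ : ℕ∞) φ → HasCompactSupport φ →
      ∫ x, w x * φ x ^ 2 ≤ ∫ x, gradDot φ φ x)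
    {f : EuclideanSpace ℝ (Fin N) → ℝ} (hf : ContDiff ℝ 2 f) (hc : HasCompactSupport f) :
    ∫ x, w x * f x ^ 2 ≤ ∫ x, gradDot f f x := by
  obtain ⟨R, M, F, hF, hs, hb, hl, hb1, hl1, -, -⟩ := exists_testFunction_approx hf hc
  have hcF : ∀ n, HasCompactSupport (F n) := fun n =>
    HasCompactSupport.intro (isCompact_closedBall 0 R) (hs n)
  have t1 := tendsto_integral_mul_sq hw (fun n => (hF n).continuous) hs hb hl
  have hF1 : ∀ n, ContDiff ℝ 1 (F n) := fun n => (hF n).of_le (by exact_mod_cast le_top)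
  have t2 := fun i => tendsto_integral_mul_sq (w := fun _ => 1) (R := R) continuous_const
    (fun n => continuous_pd (hF1 n) i)
    (fun n x hx => image_eq_zero_of_notMem_tsupport fun h =>
        hx (eq_zero_off_of_tsupport (hs n) (tsupport_pd_subset i h)))
    (hb1 i) (hl1 i)
  have e : ∀ g : EuclideanSpace ℝ (Fin N) → ℝ, ContDiff ℝ 1 g → HasCompactSupport g →
      ∫ x, gradDot g g x = ∑ i, ∫ x, 1 * pd i g x ^ 2 := by
    intro g hg hgc
    simp only [gradDot, one_mul, sq]
    refine integral_finsetSum _ fun i _ => ?_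
    exact ((continuous_pd hg i).mul (continuous_pd hg i)).integrable_of_hasCompactSupport
      ((hgc.pd i).mul_left)
  have t3 := tendsto_finsetSum Finset.univ fun i _ => t2 i
  rw [← e f (hf.of_le (by norm_num)) hc] at t3
  exact le_of_tendsto_of_tendsto' t1 t3 fun n => (hst _ (hF n) (hcF n)).trans_eq
    (e _ (hF1 n) (hcF n))

end Mollification

section Affine

variable {N : ℕ} {f : EuclideanSpace ℝ (Fin N) → ℝ}

lemma pd_comp_affine (hf : Differentiable ℝ f) (a : EuclideanSpace ℝ (Fin N)) (c : ℝ)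
    (i : Fin N) (x : EuclideanSpace ℝ (Fin N)) :
    pd i (fun y => f (a + c • y)) x = c * pd i f (a + c • x) := by
  have h1 : HasFDerivAt (fun y : EuclideanSpace ℝ (Fin N) => a + c • y)
      (c • ContinuousLinearMap.id ℝ _) x := ((hasFDerivAt_id x).const_smul c).const_add a
  have h2 := ((hf (a + c • x)).hasFDerivAt.comp x h1).fderiv
  simp only [pd]
  change fderiv ℝ (f ∘ fun y => a + c • y) x _ = _
  rw [h2]; simp

lemma lap_comp_affine (hf : ContDiff ℝ 2 f) (a : EuclideanSpace ℝ (Fin N)) (c : ℝ)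
    (x : EuclideanSpace ℝ (Fin N)) :
    lap (fun y => f (a + c • y)) x = c ^ 2 * lap f (a + c • x) := by
  have e : ∀ i, pd i (fun y => f (a + c • y)) = fun y => c * pd i f (a + c • y) := fun i => by
    ext y; exact pd_comp_affine (hf.differentiable (by norm_num)) a c i y
  simp only [lap_eq_sum_pd, e, Finset.mul_sum]
  refine Finset.sum_congr rfl fun i _ => ?_
  have h1 := (hf.pd_one i).differentiable (by norm_num)
  rw [pd_const_mul c (f := fun y => pd i f (a + c • y)) (by fun_prop), pd_comp_affine h1]
  ring

end Affine

section SquareRoot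

open Filter Topology SchwartzMap
open scoped LineDeriv Laplacian

variable {N : ℕ}

lemma SchwartzMap.laplacian_apply_eq_lap (f : 𝓢(EuclideanSpace ℝ (Fin N), ℝ))
    (x : EuclideanSpace ℝ (Fin N)) : (Δ f) x = lap f x := by
  rw [SchwartzMap.laplacian_eq_sum (EuclideanSpace.basisFun (Fin N) ℝ), lap_eq_sum_pd, sum_apply]
  refine Finset.sum_congr rfl fun i _ => ?_
  rw [EuclideanSpace.basisFun_apply]
  rfl

lemma SchwartzMap.integrable_mul (f g : 𝓢(EuclideanSpace ℝ (Fin N), ℝ)) :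
    Integrable (fun x => f x * g x) :=
  (pairing (ContinuousLinearMap.mul ℝ ℝ) f g).integrable

/-- Solvability of `ε g - Δ g = f` in the Schwartz class. -/
lemma exists_schwartz_resolvent {ε : ℝ} (hε : 0 < ε) (f : 𝓢(EuclideanSpace ℝ (Fin N), ℝ)) :
    ∃ g : 𝓢(EuclideanSpace ℝ (Fin N), ℝ), ∀ x, ε * g x - (Δ g) x = f x := by
  let m : EuclideanSpace ℝ (Fin N) → ℝ := fun ξ => (ε + (2 * π) ^ 2 * ‖ξ‖ ^ 2)⁻¹
  let q : EuclideanSpace ℝ (Fin N) → ℝ := fun ξ => ε + (2 * π) ^ 2 * ‖ξ‖ ^ 2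
  have hm : m.HasTemperateGrowth := by
    let A : EuclideanSpace ℝ (Fin N) →L[ℝ] EuclideanSpace ℝ (Fin N) :=
      (2 * π / √ε) • ContinuousLinearMap.id ℝ _
    have h := ((Function.hasTemperateGrowth_one_add_norm_sq_rpow
      (EuclideanSpace ℝ (Fin N)) (-1)).comp A.hasTemperateGrowth)
    have h2 := (Function.HasTemperateGrowth.const (E := EuclideanSpace ℝ (Fin N)) ε⁻¹).mul h
    have e : m = (fun _ => ε⁻¹) *
        ((fun x : EuclideanSpace ℝ (Fin N) => (1 + ‖x‖ ^ 2) ^ (-1 : ℝ)) ∘ A) := by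
      ext ξ
      simp only [m, A, Pi.mul_apply, Function.comp]
      rw [Real.rpow_neg_one, ← mul_inv]
      congr 1
      simp [norm_smul, mul_pow, div_pow, Real.sq_sqrt hε.le]
      field_simp
    rw [e]
    exact h2
  have hq : q.HasTemperateGrowth := by
    simp only [q]; fun_prop
  let F : 𝓢(EuclideanSpace ℝ (Fin N), ℂ) := f.postcompCLM Complex.ofRealCLM
  let G : 𝓢(EuclideanSpace ℝ (Fin N), ℂ) := fourierMultiplierCLM ℂ m F
  have hG : ε • G - Δ G = F := by
    have h1 : ε • G - Δ G = fourierMultiplierCLM ℂ q G := by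
      have hq' : q = (fun _ => ε) + ((2 * π) ^ 2 : ℝ) • (fun ξ => ‖ξ‖ ^ 2) := by
        ext ξ; simp [q]
      have hn : (fun ξ : EuclideanSpace ℝ (Fin N) => ‖ξ‖ ^ 2).HasTemperateGrowth := by fun_prop
      have hsum := fourierMultiplierCLM_sum (E := EuclideanSpace ℝ (Fin N)) ℂ
        (s := (Finset.univ : Finset (Fin 2)))
        (g := ![(fun _ => ε), ((2 * π) ^ 2 : ℝ) • (fun ξ => ‖ξ‖ ^ 2)]) (by
          intro i _
          fin_cases i
          · exact Function.HasTemperateGrowth.const ε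
          · exact (Function.HasTemperateGrowth.const ((2 * π) ^ 2 : ℝ)).mul hn)
      simp only [Fin.sum_univ_two, Matrix.cons_val_zero, Matrix.cons_val_one] at hsum
      rw [hq']
      change _ = fourierMultiplierCLM ℂ (fun x => ε + (((2 * π) ^ 2 : ℝ) • (fun ξ : EuclideanSpace ℝ (Fin N) => ‖ξ‖ ^ 2)) x) G
      rw [hsum, fourierMultiplierCLM_const, fourierMultiplierCLM_smul hn,
        laplacian_eq_fourierMultiplierCLM]
      simp [sub_eq_add_neg]
    rw [h1]
    simp only [G]
    rw [fourierMultiplierCLM_fourierMultiplierCLM_apply hq hm]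
    have : q * m = fun _ => 1 := by
      ext ξ
      exact mul_inv_cancel₀ (by positivity)
    rw [this, fourierMultiplierCLM_const]
    simp
  refine ⟨G.postcompCLM Complex.reCLM, fun x => ?_⟩
  have hΔ : (Δ (G.postcompCLM Complex.reCLM)) x = ((Δ G) x).re := by
    rw [SchwartzMap.laplacian_eq_sum (EuclideanSpace.basisFun (Fin N) ℝ),
      SchwartzMap.laplacian_eq_sum (EuclideanSpace.basisFun (Fin N) ℝ), sum_apply, sum_apply,
      Complex.re_sum]
    refine Finset.sum_congr rfl fun i _ => ?_
    have key : ∀ (v : EuclideanSpace ℝ (Fin N)) (K : 𝓢(EuclideanSpace ℝ (Fin N), ℂ)),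
        ∂_{v} (K.postcompCLM Complex.reCLM) = (∂_{v} K).postcompCLM Complex.reCLM := by
      intro v K
      ext y
      rw [lineDerivOp_apply_eq_fderiv, postcompCLM_apply, lineDerivOp_apply_eq_fderiv]
      have := (Complex.reCLM.hasFDerivAt.comp y (K.hasFDerivAt y)).fderiv
      change fderiv ℝ (Complex.reCLM ∘ K) y v = _
      rw [this]; rfl
    rw [key, key]; rfl
  rw [hΔ]
  have := congrArg (fun K : 𝓢(EuclideanSpace ℝ (Fin N), ℂ) => (K x).re) hG
  simpa [F] using this

lemma exists_cutoff (N : ℕ) : ∃ χ : EuclideanSpace ℝ (Fin N) → ℝ, ContDiff ℝ (⊤ : ℕ∞) χ ∧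
    HasCompactSupport χ ∧ (∀ x, 0 ≤ χ x) ∧ (∀ x, χ x ≤ 1) ∧
    (∀ x, ‖x‖ ≤ 1 → χ x = 1) ∧ ∀ x, 2 ≤ ‖x‖ → χ x = 0 := by
  let b : ContDiffBump (0 : EuclideanSpace ℝ (Fin N)) := ⟨1, 2, by norm_num, by norm_num⟩
  refine ⟨b, b.contDiff, b.hasCompactSupport, fun x => b.nonneg, fun x => b.le_one,
    fun x hx => b.one_of_mem_closedBall (by simpa using hx), fun x hx =>
      b.zero_of_le_dist (by simpa using hx)⟩

/-- A second order stability inequality with compactly supported weight extends to Schwartz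
functions. -/
lemma stability_schwartz {w : EuclideanSpace ℝ (Fin N) → ℝ} (hw : Continuous w)
    (hwc : HasCompactSupport w)
    (hst : ∀ φ : EuclideanSpace ℝ (Fin N) → ℝ, ContDiff ℝ (⊤ : ℕ∞) φ → HasCompactSupport φ →
      ∫ x, w x * φ x ^ 2 ≤ ∫ x, (lap φ x) ^ 2) (f : 𝓢(EuclideanSpace ℝ (Fin N), ℝ)) :
    ∫ x, w x * f x ^ 2 ≤ ∫ x, (Δ f) x ^ 2 := by
  obtain ⟨χ, hχ, hχc, hχ0, hχ1, hχe, -⟩ := exists_cutoff N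
  have hχ2 : ContDiff ℝ 2 χ := contDiff_infty.1 hχ 2
  have hχ1' : ContDiff ℝ 1 χ := hχ2.of_le (by norm_num)
  have hf2 : ContDiff ℝ 2 f := f.smooth 2
  have hf1 : Differentiable ℝ f := hf2.differentiable (by norm_num)
  let c : ℕ → ℝ := fun n => 1 / ((n : ℝ) + 1)
  have hc0 : ∀ n, 0 < c n := fun n => by positivity
  have hc1 : ∀ n, c n ≤ 1 := fun n => by
    simp only [c]; rw [div_le_one (by positivity)]; linarith [n.cast_nonneg (α := ℝ)]
  let X : ℕ → EuclideanSpace ℝ (Fin N) → ℝ := fun n x => χ (0 + c n • x)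
  have hX : ∀ n, ContDiff ℝ (⊤ : ℕ∞) (X n) := fun n => hχ.comp (by fun_prop)
  have hX2 : ∀ n, ContDiff ℝ 2 (X n) := fun n => hχ2.comp (by fun_prop)
  have hXc : ∀ n, HasCompactSupport (X n) := fun n => by
    have := hχc.comp_homeomorph (Homeomorph.smulOfNeZero (c n) (hc0 n).ne')
    convert this using 1
    ext x
    simp [X]
  have hfX : ∀ n, ContDiff ℝ (⊤ : ℕ∞) (fun x => X n x * f x) := fun n => (hX n).mul (f.smooth ⊤)
  have hfXc : ∀ n, HasCompactSupport (fun x => X n x * f x) := fun n => (hXc n).mul_right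
  have hXev : ∀ x, ∀ᶠ n in atTop, X n =ᶠ[𝓝 x] fun _ => 1 := by
    intro x
    filter_upwards [eventually_gt_atTop (Nat.ceil (‖x‖))] with n hn
    have hn' : ‖x‖ < n + 1 := by
      have h1 := Nat.le_ceil ‖x‖
      have h2 : ((Nat.ceil ‖x‖ : ℕ) : ℝ) < n := by exact_mod_cast hn
      linarith
    filter_upwards [continuous_norm.continuousAt.eventually (eventually_lt_nhds hn')] with y hy
    apply hχe
    rw [zero_add, norm_smul, Real.norm_of_nonneg (hc0 n).le]
    simp only [c]
    rw [one_div, inv_mul_le_iff₀ (by positivity)]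
    linarith
  obtain ⟨M₁, hM₁⟩ := (hχc.gradDot_right (f := χ)).exists_bound_of_continuous
    (continuous_gradDot hχ1' hχ1')
  obtain ⟨M₂, hM₂⟩ := hχc.lap.exists_bound_of_continuous (continuous_lap hχ2)
  have hM₁0 : 0 ≤ M₁ := (norm_nonneg _).trans (hM₁ 0)
  have hgX : ∀ n x, gradDot (X n) (X n) x ≤ M₁ := by
    intro n x
    have : gradDot (X n) (X n) x = c n ^ 2 * gradDot χ χ (0 + c n • x) := by
      simp only [gradDot, X, pd_comp_affine (hχ2.differentiable (by norm_num)), Finset.mul_sum]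
      exact Finset.sum_congr rfl fun i _ => by ring
    rw [this]
    have h1 := (le_abs_self _).trans (hM₁ (0 + c n • x))
    have h2 : c n ^ 2 ≤ 1 := pow_le_one₀ (hc0 n).le (hc1 n)
    have h3 : 0 ≤ gradDot χ χ (0 + c n • x) := gradDot_self_nonneg
    nlinarith [sq_nonneg (c n)]
  have hlX : ∀ n x, |lap (X n) x| ≤ M₂ := by
    intro n x
    simp only [X, lap_comp_affine hχ2, abs_mul]
    have h1 := hM₂ (0 + c n • x)
    rw [Real.norm_eq_abs] at h1
    have h2 : |c n ^ 2| ≤ 1 := by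
      rw [abs_of_nonneg (sq_nonneg _)]; exact pow_le_one₀ (hc0 n).le (hc1 n)
    nlinarith [abs_nonneg (lap χ (0 + c n • x)), abs_nonneg (c n ^ 2)]
  have t1 : Tendsto (fun n => ∫ x, w x * (X n x * f x) ^ 2) atTop (𝓝 (∫ x, w x * f x ^ 2)) := by
    refine tendsto_integral_of_dominated_convergence (fun x => |w x| * f x ^ 2) (fun n => ?_) ?_
      (fun n => ae_of_all _ fun x => ?_) (ae_of_all _ fun x => ?_)
    · exact (hw.mul ((hfX n).continuous.pow 2)).aestronglyMeasurable
    · exact (hw.abs.mul (f.continuous.pow 2)).integrable_of_hasCompactSupport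
        (HasCompactSupport.mul_right (hwc.abs))
    · rw [norm_mul, Real.norm_eq_abs, Real.norm_eq_abs, mul_pow,
        abs_of_nonneg (mul_nonneg (sq_nonneg (X n x)) (sq_nonneg (f x)))]
      have : X n x ^ 2 ≤ 1 := pow_le_one₀ (hχ0 _) (hχ1 _)
      exact mul_le_mul_of_nonneg_left (mul_le_of_le_one_left (sq_nonneg _) this) (abs_nonneg _)
    · refine tendsto_const_nhds.congr' ?_
      filter_upwards [hXev x] with n hn
      rw [hn.self_of_nhds, one_mul]
  have t2 : Tendsto (fun n => ∫ x, lap (fun x => X n x * f x) x ^ 2) atTop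
      (𝓝 (∫ x, (Δ f) x ^ 2)) := by
    refine tendsto_integral_of_dominated_convergence
      (fun x => 3 * ((Δ f) x * (Δ f) x) + 12 * M₁ * gradDot f f x + 3 * M₂ ^ 2 * (f x * f x))
      (fun n => ?_) ?_ (fun n => ae_of_all _ fun x => ?_) (ae_of_all _ fun x => ?_)
    · exact ((continuous_lap ((hX2 n).mul hf2)).pow 2).aestronglyMeasurable
    · refine (((integrable_mul (Δ f) (Δ f)).const_mul 3).add (Integrable.const_mul ?_ _)).add
        ((integrable_mul f f).const_mul _)
      refine integrable_finsetSum _ fun i _ => ?_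
      exact integrable_mul (∂_{EuclideanSpace.single i (1 : ℝ)} f)
        (∂_{EuclideanSpace.single i (1 : ℝ)} f)
    · rw [lap_mul (hX2 n) hf2, Real.norm_eq_abs, abs_of_nonneg (sq_nonneg _),
        laplacian_apply_eq_lap]
      have h1 : (X n x * lap f x) ^ 2 ≤ lap f x * lap f x := by
        rw [mul_pow, sq (lap f x)]
        exact mul_le_of_le_one_left (mul_self_nonneg _) (pow_le_one₀ (hχ0 _) (hχ1 _))
      have h2 : gradDot (X n) f x ^ 2 ≤ M₁ * gradDot f f x :=
        gradDot_sq_le.trans (mul_le_mul_of_nonneg_right (hgX n x) gradDot_self_nonneg)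
      have h3 : (f x * lap (X n) x) ^ 2 ≤ M₂ ^ 2 * (f x * f x) := by
        rw [mul_pow, mul_comm, sq (f x)]
        exact mul_le_mul_of_nonneg_right (sq_le_sq.2 ((hlX n x).trans (le_abs_self _)))
          (mul_self_nonneg _)
      have h4 : ∀ a b d : ℝ, (a + 2 * b + d) ^ 2 ≤ 3 * a ^ 2 + 12 * b ^ 2 + 3 * d ^ 2 := by
        intro a b d
        nlinarith [sq_nonneg (a - 2 * b), sq_nonneg (a - d), sq_nonneg (2 * b - d)]
      have := h4 (X n x * lap f x) (gradDot (X n) f x) (f x * lap (X n) x)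
      linarith
    · refine tendsto_const_nhds.congr' ?_
      filter_upwards [hXev x] with n hn
      have : (fun y => X n y * f y) =ᶠ[𝓝 x] f := by
        filter_upwards [hn] with y hy
        rw [hy, one_mul]
      have h2 : ∀ i, pd i (fun y => X n y * f y) =ᶠ[𝓝 x] pd i f := fun i => by
        filter_upwards [this.eventuallyEq_nhds] with y hy
        exact hy.pd_eq
      simp only [laplacian_apply_eq_lap, lap_eq_sum_pd]
      rw [Finset.sum_congr rfl fun i _ => (h2 i).pd_eq]
  exact le_of_tendsto_of_tendsto' t1 t2 fun n => hst _ (hfX n) (hfXc n)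

/-- The Laplacian is negative on Schwartz functions. -/
lemma integral_laplacian_mul_nonpos (f : 𝓢(EuclideanSpace ℝ (Fin N), ℝ)) :
    ∫ x, (Δ f) x * f x ≤ 0 := by
  rw [SchwartzMap.laplacian_eq_sum (EuclideanSpace.basisFun (Fin N) ℝ)]
  simp only [sum_apply, Finset.sum_mul]
  rw [integral_finsetSum _ fun i _ => integrable_mul _ _]
  refine Finset.sum_nonpos fun i _ => ?_
  have := integral_mul_lineDerivOp_right_eq_neg_left (μ := volume) f
    (∂_{EuclideanSpace.basisFun (Fin N) ℝ i} f) (EuclideanSpace.basisFun (Fin N) ℝ i)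
  simp only [mul_comm _ (f _)]
  rw [this]
  exact neg_nonpos.2 (integral_nonneg fun x => mul_self_nonneg _)

lemma resolvent_form_nonneg {ε : ℝ} (hε : 0 < ε) (f : 𝓢(EuclideanSpace ℝ (Fin N), ℝ)) :
    0 ≤ ∫ x, (ε * f x - (Δ f) x) * f x := by
  have h2 : ∫ x, (ε * f x - (Δ f) x) * f x = (ε * ∫ x, f x * f x) - ∫ x, (Δ f) x * f x := by
    rw [← integral_const_mul, ← integral_sub ((integrable_mul f f).const_mul _)
      (integrable_mul (Δ f) f)]
    exact integral_congr_ae (ae_of_all _ fun x => by ring)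
  rw [h2]
  have h1 := integral_laplacian_mul_nonpos f
  have h3 : 0 ≤ ∫ x, f x * f x := integral_nonneg fun x => mul_self_nonneg _
  nlinarith

/-- Cauchy-Schwarz for the quadratic form of `ε - Δ`. -/
lemma resolvent_form_cauchy_schwarz {ε : ℝ} (hε : 0 < ε)
    (f g : 𝓢(EuclideanSpace ℝ (Fin N), ℝ)) :
    (∫ x, (ε * f x - (Δ f) x) * g x) ^ 2 ≤
      (∫ x, (ε * f x - (Δ f) x) * f x) * ∫ x, (ε * g x - (Δ g) x) * g x := by
  let B : 𝓢(EuclideanSpace ℝ (Fin N), ℝ) → 𝓢(EuclideanSpace ℝ (Fin N), ℝ) → ℝ :=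
    fun f g => ∫ x, (ε • f - Δ f) x * g x
  have hsymm : ∀ f g, B f g = B g f := by
    intro f g
    simp only [B, sub_apply, smul_apply, sub_mul, smul_eq_mul]
    rw [integral_sub, integral_sub]
    · rw [← integral_mul_laplacian_right_eq_left f g]
      congr 1 <;> exact integral_congr_ae (ae_of_all _ fun x => by ring)
    · simpa using integrable_mul (ε • g) f
    · exact integrable_mul (Δ g) f
    · simpa using integrable_mul (ε • f) g
    · exact integrable_mul (Δ f) g
  have hpos : ∀ f, 0 ≤ B f f := fun f => resolvent_form_nonneg hε f
  have hlin : ∀ (t : ℝ) f g h, B (f + t • g) h = B f h + t * B g h := by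
    intro t f g h
    have e : ε • (f + t • g) - Δ (f + t • g) = (ε • f - Δ f) + t • (ε • g - Δ g) := by
      ext x
      simp only [laplacian_apply_eq_lap, sub_apply, add_apply, smul_apply, smul_eq_mul]
      rw [show ⇑(f + t • g) = fun y => f y - (-t) * g y by ext y; simp,
        lap_sub (f.smooth 2) (contDiff_const.mul (g.smooth 2)), lap_const_mul _ (g.smooth 2)]
      ring
    simp only [B, e]
    rw [← integral_const_mul, ← integral_add (integrable_mul _ _)
      ((integrable_mul _ _).const_mul _)]
    exact integral_congr_ae (ae_of_all _ fun x => by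
      simp only [add_apply, smul_apply, smul_eq_mul]; ring)
  have hquad : ∀ t : ℝ, 0 ≤ B g g * (t * t) + (2 * B f g) * t + B f f := by
    intro t
    have h1 := hpos (f + t • g)
    rw [hlin, hsymm f, hsymm g, hlin, hlin, hsymm g f] at h1
    linarith
  have := discrim_le_zero hquad
  simp only [discrim] at this
  have hB : ∀ f g, ∫ x, (ε * f x - (Δ f) x) * g x = B f g := fun f g => rfl
  rw [hB, hB, hB]
  nlinarith

/-- Operator monotonicity of the square root, for a smooth compactly supported potential. -/
lemma first_order_of_second_order_smooth {w : EuclideanSpace ℝ (Fin N) → ℝ}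
    (hw : ContDiff ℝ (⊤ : ℕ∞) w) (hwc : HasCompactSupport w)
    (hst : ∀ φ : EuclideanSpace ℝ (Fin N) → ℝ, ContDiff ℝ (⊤ : ℕ∞) φ → HasCompactSupport φ →
      ∫ x, w x ^ 2 * φ x ^ 2 ≤ ∫ x, (lap φ x) ^ 2) {ε : ℝ} (hε : 0 < ε)
    (f : 𝓢(EuclideanSpace ℝ (Fin N), ℝ)) :
    ∫ x, w x * f x ^ 2 ≤ ∫ x, (ε * f x - (Δ f) x) * f x := by
  have hwt : w.HasTemperateGrowth := (hwc.toSchwartzMap hw).hasTemperateGrowth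
  choose T hT using fun g => exists_schwartz_resolvent (N := N) hε g
  let F : ℕ → 𝓢(EuclideanSpace ℝ (Fin N), ℝ) := fun k =>
    Nat.rec f (fun _ g => T (smulLeftCLM ℝ w g)) k
  have hF : ∀ k x, ε * F (k + 1) x - (Δ (F (k + 1))) x = w x * F k x := by
    intro k x
    have := hT (smulLeftCLM ℝ w (F k)) x
    rw [smulLeftCLM_apply_apply hwt] at this
    exact this
  let B : ℕ → ℕ → ℝ := fun k j => ∫ x, (ε * F k x - (Δ (F k)) x) * F j x
  have hB1 : ∀ k j, B (k + 1) j = ∫ x, w x * F k x * F j x := fun k j => by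
    simp only [B, hF]
  have hsymm : ∀ k j, B k j = B j k := by
    intro k j
    simp only [B, sub_mul]
    rw [integral_sub, integral_sub]
    · rw [← integral_mul_laplacian_right_eq_left (F k) (F j)]
      congr 1 <;> exact integral_congr_ae (ae_of_all _ fun x => by ring)
    · simpa using integrable_mul (ε • F j) (F k)
    · exact integrable_mul (Δ (F j)) (F k)
    · simpa using integrable_mul (ε • F k) (F j)
    · exact integrable_mul (Δ (F k)) (F j)
  have hshift : ∀ k j, B (k + 1) j = B k (j + 1) := by
    intro k j
    rw [hsymm k (j + 1), hB1, hB1]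
    exact integral_congr_ae (ae_of_all _ fun x => by ring)
  have hB : ∀ k j, B k j = B (k + j) 0 := by
    intro k j
    induction j generalizing k with
    | zero => rfl
    | succ j ih =>
      exact (hshift k j).symm.trans ((ih (k + 1)).trans (by rw [Nat.add_right_comm]; rfl))
  let a : ℕ → ℝ := fun m => B m 0
  have hCS : ∀ k, a k ^ 2 ≤ a 0 * a (2 * k) := by
    intro k
    have h := resolvent_form_cauchy_schwarz hε (F k) (F 0)
    change B k 0 ^ 2 ≤ B k k * B 0 0 at h
    rw [hB k k, ← two_mul, mul_comm] at h
    exact h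
  have ha0 : 0 ≤ a 0 := resolvent_form_nonneg hε f
  have hint : ∀ k, Integrable fun x => (w x * F k x) ^ 2 := fun k =>
    (((hw.continuous.mul (F k).continuous).pow 2).integrable_of_hasCompactSupport
      (by simp only [sq]; exact (hwc.mul_right).mul_right))
  have hnorm : ∀ k, ∫ x, (w x * F (k + 1) x) ^ 2 ≤ ∫ x, (w x * F k x) ^ 2 := by
    intro k
    have h1 := stability_schwartz (w := fun x => w x ^ 2) (hw.continuous.pow 2)
      (by simp only [sq]; exact hwc.mul_right) hst (F (k + 1))
    simp only [mul_pow] at h1 ⊢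
    refine h1.trans ?_
    have h2 : ∫ x, w x ^ 2 * F k x ^ 2 = ∫ x, ((Δ (F (k + 1))) x * (Δ (F (k + 1))) x +
        2 * ε * -((Δ (F (k + 1))) x * F (k + 1) x) + ε ^ 2 * (F (k + 1) x * F (k + 1) x)) :=
      integral_congr_ae (ae_of_all _ fun x => by
        have := hF k x
        simp only [← mul_pow, ← this]; ring)
    have i1 := integrable_mul (Δ (F (k + 1))) (Δ (F (k + 1)))
    have i2 : Integrable fun x => 2 * ε * -((Δ (F (k + 1))) x * F (k + 1) x) :=
      ((integrable_mul (Δ (F (k + 1))) (F (k + 1))).neg).const_mul (2 * ε)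
    have i12 : Integrable fun x => (Δ (F (k + 1))) x * (Δ (F (k + 1))) x +
        2 * ε * -((Δ (F (k + 1))) x * F (k + 1) x) := i1.add i2
    have i3 := (integrable_mul (F (k + 1)) (F (k + 1))).const_mul (ε ^ 2)
    have e3 : ∫ x, w x ^ 2 * F k x ^ 2 = ((∫ x, (Δ (F (k + 1))) x * (Δ (F (k + 1))) x) +
        2 * ε * -∫ x, (Δ (F (k + 1))) x * F (k + 1) x) +
          ε ^ 2 * ∫ x, F (k + 1) x * F (k + 1) x := by
      rw [h2, ← integral_neg, ← integral_const_mul, ← integral_const_mul, ← integral_add i1 i2,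
        ← integral_add i12 i3]
    have h4 := integral_laplacian_mul_nonpos (F (k + 1))
    have h5 : 0 ≤ ∫ x, F (k + 1) x * F (k + 1) x := integral_nonneg fun x => mul_self_nonneg _
    simp only [sq ((Δ (F (k + 1))) _)]
    rw [e3]
    nlinarith [mul_nonneg (sq_nonneg ε) h5]
  have hbound : ∃ M, ∀ m, a (m + 1) ≤ M := by
    refine ⟨(∫ x, (w x * F 0 x) ^ 2) + ∫ x, f x * f x, fun m => ?_⟩
    have h1 : ∫ x, (w x * F m x) ^ 2 ≤ ∫ x, (w x * F 0 x) ^ 2 := by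
      induction m with
      | zero => exact le_rfl
      | succ m ih => exact (hnorm m).trans ih
    refine le_trans ?_ (add_le_add h1 le_rfl)
    rw [← integral_add (hint m) (integrable_mul f f)]
    change B (m + 1) 0 ≤ _
    rw [hB1]
    refine integral_mono ?_ ((hint m).add (integrable_mul f f)) fun x => ?_
    · exact ((hw.continuous.mul (F m).continuous).mul
        (F 0).continuous).integrable_of_hasCompactSupport (hwc.mul_right.mul_right)
    · change w x * F m x * f x ≤ (w x * F m x) ^ 2 + f x * f x
      nlinarith [sq_nonneg (w x * F m x - f x), sq_nonneg (w x * F m x + f x)]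
  have h10 : ∫ x, w x * f x ^ 2 = a 1 := by
    change _ = B (0 + 1) 0
    rw [hB1]
    exact integral_congr_ae (ae_of_all _ fun x => by
      change w x * f x ^ 2 = w x * f x * f x
      ring)
  rw [h10]
  change a 1 ≤ a 0
  by_contra hlt
  push Not at hlt
  have hpos : 0 < a 0 := by
    rcases ha0.lt_or_eq with h | h
    · exact h
    · have := hCS 1
      rw [← h, zero_mul] at this
      nlinarith
  obtain ⟨M, hM⟩ := hbound
  have hr : 1 < a 1 / a 0 := (one_lt_div hpos).2 hlt
  have hgrow : ∀ n : ℕ, a 0 * (a 1 / a 0) ^ (2 ^ n) ≤ a (2 ^ n) := by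
    intro n
    induction n with
    | zero => simp [mul_div_cancel₀ _ hpos.ne']
    | succ n ih =>
      have h1 := hCS (2 ^ n)
      have h2 : (a 0 * (a 1 / a 0) ^ (2 ^ n)) ^ 2 ≤ a (2 ^ n) ^ 2 :=
        pow_le_pow_left₀ (by positivity) ih 2
      rw [pow_succ' 2 n]
      refine le_of_mul_le_mul_left ?_ hpos
      calc a 0 * (a 0 * (a 1 / a 0) ^ (2 * 2 ^ n)) = (a 0 * (a 1 / a 0) ^ (2 ^ n)) ^ 2 := by
            rw [mul_comm 2 (2 ^ n), pow_mul]; ring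
        _ ≤ _ := h2.trans h1
  obtain ⟨n, hn⟩ := pow_unbounded_of_one_lt (M / a 0) hr
  have h1 : (a 1 / a 0) ^ n ≤ (a 1 / a 0) ^ (2 ^ n) :=
    pow_le_pow_right₀ hr.le n.lt_two_pow_self.le
  have h2 := hM (2 ^ n - 1)
  rw [Nat.sub_add_cancel Nat.one_le_two_pow] at h2
  have h3 := (hgrow n).trans h2
  rw [div_lt_iff₀ hpos] at hn
  nlinarith

end SquareRoot

section FirstOrder

open Filter Topology

variable {N : ℕ}

/-- The square root of a second order stability inequality is a first order one. -/
lemma first_order_of_second_order {V : EuclideanSpace ℝ (Fin N) → ℝ} (hV : Continuous V)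
    (hV0 : ∀ x, 0 < V x)
    (hst : ∀ φ : EuclideanSpace ℝ (Fin N) → ℝ, ContDiff ℝ (⊤ : ℕ∞) φ → HasCompactSupport φ →
      ∫ x, V x ^ 2 * φ x ^ 2 ≤ ∫ x, (lap φ x) ^ 2)
    {f : EuclideanSpace ℝ (Fin N) → ℝ} (hf : ContDiff ℝ 2 f) (hc : HasCompactSupport f) :
    ∫ x, V x * f x ^ 2 ≤ ∫ x, gradDot f f x := by
  refine first_order_C2 hV (fun φ hφ hφc => ?_) hf hc
  have hφ2 : ContDiff ℝ 2 φ := contDiff_infty.1 hφ 2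
  have hint : ∀ {w : EuclideanSpace ℝ (Fin N) → ℝ}, Continuous w → ∀ ψ, Continuous ψ →
      HasCompactSupport ψ → Integrable fun x => w x * ψ x ^ 2 := fun {w} hw ψ hψ hψc =>
    (hw.mul (hψ.pow 2)).integrable_of_hasCompactSupport
      (by simp only [sq]; exact (hψc.mul_right).mul_left)
  have key : ∀ δ : ℝ, 0 < δ →
      ∫ x, V x * φ x ^ 2 ≤ (∫ x, gradDot φ φ x) + 2 * δ * ∫ x, φ x ^ 2 := by
    intro δ hδ
    obtain ⟨g, hg, hgd, -⟩ := Continuous.exists_contDiff_approx (⊤ : ℕ∞)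
      (f := fun x => V x - min δ (V x) / 2) (ε := fun x => min δ (V x) / 2)
      (hV.sub ((continuous_const.min hV).div_const 2)) ((continuous_const.min hV).div_const 2)
      (fun x => half_pos (lt_min hδ (hV0 x)))
    have hgd' : ∀ x, V x - min δ (V x) < g x ∧ g x < V x := fun x => by
      have := abs_lt.1 (hgd x)
      constructor <;> linarith [this.1, this.2]
    obtain ⟨R, hR0, hR⟩ : ∃ R : ℝ, 0 < R ∧ tsupport φ ⊆ Metric.closedBall 0 R := by
      obtain ⟨R, hR⟩ := hφc.isCompact.isBounded.subset_closedBall 0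
      exact ⟨max R 1, by positivity, hR.trans (Metric.closedBall_subset_closedBall (le_max_left _ _))⟩
    let b : ContDiffBump (0 : EuclideanSpace ℝ (Fin N)) := ⟨R, R + 1, hR0, by linarith⟩
    have hW : ContDiff ℝ (⊤ : ℕ∞) fun x => b x * g x := b.contDiff.mul hg
    have hWc : HasCompactSupport fun x => b x * g x := b.hasCompactSupport.mul_right
    have hg0 : ∀ x, 0 ≤ g x := fun x => by linarith [(hgd' x).1, min_le_right δ (V x)]
    have hWV : ∀ x, b x * g x ≤ V x := fun x =>
      (mul_le_of_le_one_left (hg0 x) b.le_one).trans (hgd' x).2.le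
    have h2 : ∫ x, (δ * φ x - lap φ x) * φ x = (δ * ∫ x, φ x ^ 2) + ∫ x, gradDot φ φ x := by
      have := integral_lap_mul hφ2 (hφ2.of_le (by norm_num)) hφc
      rw [← neg_eq_iff_eq_neg] at this
      rw [← this, ← sub_eq_add_neg, ← integral_const_mul, ← integral_sub]
      · exact integral_congr_ae (ae_of_all _ fun x => by ring)
      · exact hint continuous_const _ hφ.continuous hφc
      · exact ((continuous_lap hφ2).mul hφ.continuous).integrable_of_hasCompactSupport
          hφc.mul_left
    have h1 := first_order_of_second_order_smooth hW hWc (fun ψ hψ hψc => by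
      refine (integral_mono (hint (hW.continuous.pow 2) _ hψ.continuous hψc)
        (hint (hV.pow 2) _ hψ.continuous hψc) fun x => ?_).trans (hst ψ hψ hψc)
      exact mul_le_mul_of_nonneg_right (pow_le_pow_left₀ (mul_nonneg b.nonneg (hg0 x)) (hWV x) 2)
        (sq_nonneg _)) hδ (hφc.toSchwartzMap hφ)
    simp only [SchwartzMap.laplacian_apply_eq_lap, HasCompactSupport.toSchwartzMap_toFun] at h1
    change _ ≤ ∫ x, (δ * φ x - lap φ x) * φ x at h1
    rw [h2] at h1
    have h3 : ∫ x, (V x - δ) * φ x ^ 2 ≤ ∫ x, b x * g x * φ x ^ 2 := by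
      refine integral_mono (hint (hV.sub continuous_const) _ hφ.continuous hφc)
        (hint hW.continuous _ hφ.continuous hφc) fun x => ?_
      by_cases hx : x ∈ tsupport φ
      · have hb : b x = 1 := b.one_of_mem_closedBall (hR hx)
        simp only [hb, one_mul]
        exact mul_le_mul_of_nonneg_right (by linarith [(hgd' x).1, min_le_left δ (V x)])
          (sq_nonneg _)
      · simp [image_eq_zero_of_notMem_tsupport hx]
    have h4 : ∫ x, (V x - δ) * φ x ^ 2 = (∫ x, V x * φ x ^ 2) - δ * ∫ x, φ x ^ 2 := by
      rw [← integral_const_mul, ← integral_sub (hint hV _ hφ.continuous hφc)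
        (hint continuous_const _ hφ.continuous hφc)]
      exact integral_congr_ae (ae_of_all _ fun x => by ring)
    linarith
  have hA : 0 ≤ ∫ x, φ x ^ 2 := integral_nonneg fun x => sq_nonneg _
  refine le_of_forall_pos_le_add fun ε hε => ?_
  refine (key (ε / (2 * ((∫ x, φ x ^ 2) + 1))) (by positivity)).trans ?_
  gcongr
  rw [show 2 * (ε / (2 * ((∫ x, φ x ^ 2) + 1))) * (∫ x, φ x ^ 2) =
    ε * ((∫ x, φ x ^ 2) / ((∫ x, φ x ^ 2) + 1)) by field_simp]
  exact mul_le_of_le_one_right hε.le ((div_le_one (by positivity)).2 (by linarith))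

end FirstOrder

section Solutions

variable {N : ℕ} {p : ℝ} {u : EuclideanSpace ℝ (Fin N) → ℝ}

/-- Classical stable solutions of `Δ²u = u^p`, `u > 0`. -/
structure IsStableSol (p : ℝ) (u : EuclideanSpace ℝ (Fin N) → ℝ) : Prop where
  contDiff : ContDiff ℝ 4 u
  pos : ∀ x, 0 < u x
  lap_lap : ∀ x, lap (lap u) x = u x ^ p
  stable : ∀ φ : EuclideanSpace ℝ (Fin N) → ℝ, ContDiff ℝ (⊤ : ℕ∞) φ → HasCompactSupport φ →
    p * ∫ x, u x ^ (p - 1) * φ x ^ 2 ≤ ∫ x, (lap φ x) ^ 2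

lemma integral_comp_affine (F : EuclideanSpace ℝ (Fin N) → ℝ) (a : EuclideanSpace ℝ (Fin N))
    {R : ℝ} (hR : 0 < R) : ∫ x, F (a + R • x) = (R ^ N)⁻¹ * ∫ x, F x := by
  have h := Measure.integral_comp_smul (volume : Measure (EuclideanSpace ℝ (Fin N)))
    (fun x => F (a + x)) R
  rw [h, integral_add_left_eq_self F a, finrank_euclideanSpace_fin, abs_of_pos (by positivity),
    smul_eq_mul]

/-- The rescaling of a function that preserves the equation. -/
noncomputable def rescale (p : ℝ) (u : EuclideanSpace ℝ (Fin N) → ℝ)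
    (a : EuclideanSpace ℝ (Fin N)) (R : ℝ) (x : EuclideanSpace ℝ (Fin N)) : ℝ :=
  R ^ (4 / (p - 1)) * u (a + R • x)

lemma lap_rescale (hu : ContDiff ℝ 2 u) (a : EuclideanSpace ℝ (Fin N)) {R : ℝ}
    (x : EuclideanSpace ℝ (Fin N)) :
    lap (rescale p u a R) x = R ^ (4 / (p - 1)) * R ^ 2 * lap u (a + R • x) := by
  unfold rescale
  rw [lap_const_mul (f := fun x => u (a + R • x)) _ (hu.comp (by fun_prop)), lap_comp_affine hu]
  ring

namespace IsStableSol

lemma lap_contDiff (h : IsStableSol p u) : ContDiff ℝ 2 (lap u) :=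
  contDiff_lap (m := 2) (n := 4) h.contDiff (by norm_num)

lemma contDiff_two (h : IsStableSol p u) : ContDiff ℝ 2 u := h.contDiff.of_le (by norm_num)

lemma contDiff_one (h : IsStableSol p u) : ContDiff ℝ 1 u := h.contDiff.of_le (by norm_num)

lemma continuous_rpow (h : IsStableSol p u) (a : ℝ) : Continuous fun x => u x ^ a :=
  h.contDiff.continuous.rpow_const fun x => Or.inl (h.pos x).ne'

lemma rescale (h : IsStableSol p u) (hp : 1 < p) (a : EuclideanSpace ℝ (Fin N)) {R : ℝ}
    (hR : 0 < R) : IsStableSol p (rescale p u a R) where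
  contDiff := contDiff_const.mul (h.contDiff.comp (by fun_prop))
  pos x := mul_pos (rpow_pos_of_pos hR _) (h.pos _)
  lap_lap x := by
    have hp' : p - 1 ≠ 0 := by linarith
    have e : lap (_root_.rescale p u a R) =
        fun x => (R ^ (4 / (p - 1)) * R ^ 2) * lap u (a + R • x) := by
      ext x; exact lap_rescale h.contDiff_two a x
    rw [e, lap_const_mul (f := fun x => lap u (a + R • x)) _ (h.lap_contDiff.comp (by fun_prop)),
      lap_comp_affine h.lap_contDiff, h.lap_lap, _root_.rescale,
      mul_rpow (rpow_nonneg hR.le _) (h.pos _).le, ← rpow_mul hR.le,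
      show 4 / (p - 1) * p = 4 / (p - 1) + (4 : ℕ) by push_cast; field_simp; ring,
      rpow_add hR, rpow_natCast]
    ring
  stable φ hφ hφc := by
    have hp' : p - 1 ≠ 0 := by linarith
    have hR' : R ≠ 0 := hR.ne'
    have hφ2 : ContDiff ℝ 2 φ := contDiff_infty.1 hφ 2
    let b : EuclideanSpace ℝ (Fin N) := -(R⁻¹ • a)
    have hab : ∀ x, b + R⁻¹ • (a + R • x) = x := fun x => by
      simp [b, smul_smul, hR']
    have hψ : ContDiff ℝ (⊤ : ℕ∞) fun y => φ (b + R⁻¹ • y) := hφ.comp (by fun_prop)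
    have hψc : HasCompactSupport fun y => φ (b + R⁻¹ • y) :=
      hφc.comp_homeomorph ((Homeomorph.smulOfNeZero R⁻¹ (inv_ne_zero hR')).trans
        (Homeomorph.addLeft b))
    have h1 := h.stable _ hψ hψc
    have e1 := integral_comp_affine (fun x => u x ^ (p - 1) * φ (b + R⁻¹ • x) ^ 2) a hR
    have e2 := integral_comp_affine (fun x => lap φ x ^ 2) b (inv_pos.2 hR)
    simp only [hab] at e1
    simp only [lap_comp_affine hφ2, mul_pow, integral_const_mul, e2] at h1
    have e3 : ∀ x, _root_.rescale p u a R x ^ (p - 1) * φ x ^ 2 =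
        R ^ 4 * (u (a + R • x) ^ (p - 1) * φ x ^ 2) := fun x => by
      rw [_root_.rescale, mul_rpow (rpow_nonneg hR.le _) (h.pos _).le, ← rpow_mul hR.le,
        div_mul_cancel₀ _ hp', mul_assoc]
      norm_cast
    simp only [e3, integral_const_mul, e1]
    have h2 := mul_le_mul_of_nonneg_left h1 (show 0 ≤ R ^ 4 * (R ^ N)⁻¹ by positivity)
    calc _ = R ^ 4 * (R ^ N)⁻¹ * (p * ∫ x, u x ^ (p - 1) * φ (b + R⁻¹ • x) ^ 2) := by ring
      _ ≤ _ := h2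
      _ = _ := by simp only [inv_pow, inv_inv]; field_simp

end IsStableSol

/-- Bounds for the derivatives of powers of a cutoff function. -/
lemma exists_bound_cutoff_pow {ζ : EuclideanSpace ℝ (Fin N) → ℝ} (hζ : ContDiff ℝ 2 ζ)
    (hζc : HasCompactSupport ζ) (h0 : ∀ x, 0 ≤ ζ x) (h1 : ∀ x, ζ x ≤ 1) (j : ℕ) :
    ∃ C, 0 ≤ C ∧ (∀ x, |lap (fun y => ζ y ^ (j + 2)) x| ≤ C * ζ x ^ j) ∧
      ∀ x, gradDot (fun y => ζ y ^ (j + 2)) (fun y => ζ y ^ (j + 2)) x ≤ C * ζ x ^ (2 * j + 2) := by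
  have hζ1 : ContDiff ℝ 1 ζ := hζ.of_le (by norm_num)
  obtain ⟨M₁, hM₁⟩ := (hζc.gradDot_right (f := ζ)).exists_bound_of_continuous
    (continuous_gradDot hζ1 hζ1)
  obtain ⟨M₂, hM₂⟩ := hζc.lap.exists_bound_of_continuous (continuous_lap hζ)
  have hM₁0 : 0 ≤ M₁ := (norm_nonneg _).trans (hM₁ 0)
  have hM₂0 : 0 ≤ M₂ := (norm_nonneg _).trans (hM₂ 0)
  have hd : ∀ x, DifferentiableAt ℝ ζ x := hζ1.differentiable (by norm_num)
  refine ⟨((j + 2 : ℕ) : ℝ) ^ 2 * (M₁ + M₂), by positivity, fun x => ?_, fun x => ?_⟩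
  · rw [lap_pow _ hζ]
    have e1 : j + 2 - 1 = j + 1 := rfl
    have e2 : j + 2 - 2 = j := rfl
    rw [e1, e2]
    have a1 := hM₁ x
    have a2 := hM₂ x
    rw [Real.norm_eq_abs] at a1 a2
    have hz : 0 ≤ ζ x ^ j := pow_nonneg (h0 x) j
    have hj : (1 : ℝ) ≤ ((j + 2 : ℕ) : ℝ) := by exact_mod_cast Nat.le_add_left 1 (j + 1)
    have hj' : ((j + 1 : ℕ) : ℝ) ≤ ((j + 2 : ℕ) : ℝ) := by exact_mod_cast Nat.le_succ _
    have hj0 : (0 : ℝ) ≤ ((j + 1 : ℕ) : ℝ) := Nat.cast_nonneg _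
    generalize ((j + 2 : ℕ) : ℝ) = k at *
    generalize ((j + 1 : ℕ) : ℝ) = k' at *
    calc |k * ζ x ^ (j + 1) * lap ζ x + k * k' * ζ x ^ j * gradDot ζ ζ x|
        ≤ |k * ζ x ^ (j + 1) * lap ζ x| + |k * k' * ζ x ^ j * gradDot ζ ζ x| := abs_add_le _ _
      _ ≤ k ^ 2 * M₂ * ζ x ^ j + k ^ 2 * M₁ * ζ x ^ j := by
        rw [abs_mul, abs_mul, abs_mul, abs_mul (k * k'), abs_mul k,
          abs_of_nonneg (zero_le_one.trans hj), abs_of_nonneg hj0, abs_of_nonneg hz,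
          abs_of_nonneg (pow_nonneg (h0 x) (j + 1)), pow_succ]
        refine add_le_add ?_ ?_
        · have b1 : ζ x ^ j * ζ x * |lap ζ x| ≤ M₂ * ζ x ^ j := by
            have := mul_le_mul (h1 x) a2 (abs_nonneg _) zero_le_one
            nlinarith
          have b2 : 0 ≤ M₂ * ζ x ^ j := mul_nonneg hM₂0 hz
          have b3 := mul_le_mul_of_nonneg_left b1 (zero_le_one.trans hj)
          have b4 := mul_le_mul_of_nonneg_right (show k ≤ k ^ 2 by nlinarith) b2
          linarith
        · have b1 : k * k' ≤ k ^ 2 := by nlinarith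
          have b2 : ζ x ^ j * |gradDot ζ ζ x| ≤ M₁ * ζ x ^ j := by nlinarith
          have b3 : 0 ≤ ζ x ^ j * |gradDot ζ ζ x| := mul_nonneg hz (abs_nonneg _)
          have := mul_le_mul b1 b2 b3 (sq_nonneg k)
          linarith
      _ = _ := by ring
  · rw [gradDot_pow_left _ (hd x), gradDot_pow_right _ (hd x)]
    have e1 : j + 2 - 1 = j + 1 := rfl
    rw [e1]
    have a1 := (le_abs_self _).trans (hM₁ x)
    calc _ = ((j + 2 : ℕ) : ℝ) ^ 2 * gradDot ζ ζ x * ζ x ^ (2 * j + 2) := by ring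
      _ ≤ _ := by
        gcongr
        · exact pow_nonneg (h0 x) _
        · linarith

end Solutions

section Energy

variable {N : ℕ} {p : ℝ} {u : EuclideanSpace ℝ (Fin N) → ℝ}

lemma integral_le_combo₂ {α : Type*} [MeasurableSpace α] {μ : Measure α} {f g₁ g₂ : α → ℝ}
    (hf : Integrable f μ) (h₁ : Integrable g₁ μ) (h₂ : Integrable g₂ μ) (c₁ c₂ : ℝ)
    (h : ∀ x, f x ≤ c₁ * g₁ x + c₂ * g₂ x) :
    ∫ x, f x ∂μ ≤ c₁ * (∫ x, g₁ x ∂μ) + c₂ * ∫ x, g₂ x ∂μ := by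
  rw [← integral_const_mul, ← integral_const_mul,
    ← integral_add (h₁.const_mul _) (h₂.const_mul _)]
  exact integral_mono hf ((h₁.const_mul _).add (h₂.const_mul _)) h

lemma integral_le_combo₃ {α : Type*} [MeasurableSpace α] {μ : Measure α} {f g₁ g₂ g₃ : α → ℝ}
    (hf : Integrable f μ) (h₁ : Integrable g₁ μ) (h₂ : Integrable g₂ μ) (h₃ : Integrable g₃ μ)
    (c₁ c₂ c₃ : ℝ) (h : ∀ x, f x ≤ c₁ * g₁ x + c₂ * g₂ x + c₃ * g₃ x) :
    ∫ x, f x ∂μ ≤ c₁ * (∫ x, g₁ x ∂μ) + c₂ * (∫ x, g₂ x ∂μ) + c₃ * ∫ x, g₃ x ∂μ := by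
  have := integral_le_combo₂ hf ((h₁.const_mul c₁).add (h₂.const_mul c₂)) h₃ 1 c₃
    (fun x => by simpa using h x)
  simpa only [Pi.add_apply, integral_add (h₁.const_mul c₁) (h₂.const_mul c₂),
    integral_const_mul, one_mul] using this

lemma integral_le_combo₄ {α : Type*} [MeasurableSpace α] {μ : Measure α} {f g₁ g₂ g₃ g₄ : α → ℝ}
    (hf : Integrable f μ) (h₁ : Integrable g₁ μ) (h₂ : Integrable g₂ μ) (h₃ : Integrable g₃ μ)
    (h₄ : Integrable g₄ μ) (c₁ c₂ c₃ c₄ : ℝ)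
    (h : ∀ x, f x ≤ c₁ * g₁ x + c₂ * g₂ x + c₃ * g₃ x + c₄ * g₄ x) :
    ∫ x, f x ∂μ ≤ c₁ * (∫ x, g₁ x ∂μ) + c₂ * (∫ x, g₂ x ∂μ) + c₃ * (∫ x, g₃ x ∂μ) +
      c₄ * ∫ x, g₄ x ∂μ := by
  have := integral_le_combo₃ hf ((h₁.const_mul c₁).add (h₂.const_mul c₂)) h₃ h₄ 1 c₃ c₄
    (fun x => by simpa using h x)
  simpa only [Pi.add_apply, integral_add (h₁.const_mul c₁) (h₂.const_mul c₂),
    integral_const_mul, one_mul] using this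

lemma exists_young_cutoff (hp : 1 < p) {k : ℕ} (hk : 1 ≤ k) (hk' : 8 / (p - 1) ≤ 2 * k - 1) {δ : ℝ}
    (hδ : 0 < δ) : ∃ C, 0 ≤ C ∧ ∀ a t : ℝ, 0 < a → 0 ≤ t → t ≤ 1 →
      a ^ 2 * t ^ (2 * k) ≤ δ * (a ^ (p + 1) * t ^ (2 * k + 4)) + C * t := by
  have hp' : 0 < p - 1 := by linarith
  refine ⟨(1 / δ) ^ (2 / (p - 1)), by positivity, fun a t ha ht ht1 => ?_⟩
  have e : a ^ (p + 1) = a ^ (p - 1) * a ^ 2 := by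
    rw [← rpow_natCast a 2, ← rpow_add ha]; congr 1; push_cast; ring
  rcases le_or_gt (1 / δ) (a ^ (p - 1) * t ^ 4) with h | h
  · have h1 : 1 ≤ δ * (a ^ (p - 1) * t ^ 4) := by
      rw [div_le_iff₀ hδ] at h; linarith
    have h2 : 0 ≤ a ^ 2 * t ^ (2 * k) := by positivity
    have h3 := mul_le_mul_of_nonneg_right h1 h2
    have h4 : 0 ≤ (1 / δ) ^ (2 / (p - 1)) * t := by positivity
    rw [e]
    calc _ ≤ δ * (a ^ (p - 1) * t ^ 4) * (a ^ 2 * t ^ (2 * k)) := by linarith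
      _ = δ * (a ^ (p - 1) * a ^ 2 * t ^ (2 * k + 4)) := by ring
      _ ≤ _ := by linarith
  · have h1 : (a ^ (p - 1) * t ^ 4) ^ (2 / (p - 1)) ≤ (1 / δ) ^ (2 / (p - 1)) :=
      rpow_le_rpow (by positivity) h.le (by positivity)
    have h2 : (a ^ (p - 1) * t ^ 4) ^ (2 / (p - 1)) = a ^ 2 * t ^ (8 / (p - 1)) := by
      rw [mul_rpow (by positivity) (by positivity), ← rpow_mul ha.le, mul_div_cancel₀ _ hp'.ne',
        ← rpow_natCast t 4, ← rpow_mul ht]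
      norm_cast
      congr 2
      ring
    have h3 : t ^ (2 * k - 1) ≤ t ^ (8 / (p - 1)) := by
      rw [← rpow_natCast]
      refine rpow_le_rpow_of_exponent_ge' ht ht1 (by positivity) ?_
      rw [Nat.cast_sub (by omega)]
      push_cast
      linarith
    rw [h2] at h1
    have h5 : a ^ 2 * t ^ (2 * k) = a ^ 2 * t ^ (2 * k - 1) * t := by
      rw [mul_assoc, ← pow_succ, Nat.sub_add_cancel (by omega)]
    rw [h5]
    have h6 : a ^ 2 * t ^ (2 * k - 1) ≤ (1 / δ) ^ (2 / (p - 1)) :=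
      (mul_le_mul_of_nonneg_left h3 (sq_nonneg a)).trans h1
    have h7 := mul_le_mul_of_nonneg_right h6 ht
    have h8 : 0 ≤ δ * (a ^ (p + 1) * t ^ (2 * k + 4)) := by positivity
    linarith

lemma integrable_mul_pow_cutoff {ζ g : EuclideanSpace ℝ (Fin N) → ℝ} (hζ : Continuous ζ)
    (hζc : HasCompactSupport ζ) (hg : Continuous g) {j : ℕ} (hj : j ≠ 0) :
    Integrable fun x => g x * ζ x ^ j := by
  obtain ⟨i, rfl⟩ := Nat.exists_eq_succ_of_ne_zero hj
  refine (hg.mul (hζ.pow _)).integrable_of_hasCompactSupport ?_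
  simp only [pow_succ]
  exact HasCompactSupport.mul_left hζc.mul_left

lemma energy_estimate_cutoff (hp : 1 < p) {ζ : EuclideanSpace ℝ (Fin N) → ℝ}
    (hζ : ContDiff ℝ 2 ζ) (hζc : HasCompactSupport ζ) (h0 : ∀ x, 0 ≤ ζ x) (h1 : ∀ x, ζ x ≤ 1)
    {k : ℕ} (hk : 1 ≤ k) (hk' : 8 / (p - 1) ≤ 2 * k - 1) :
    ∃ C, ∀ u : EuclideanSpace ℝ (Fin N) → ℝ, IsStableSol p u →
      ∫ x, (lap u x ^ 2 + u x ^ (p + 1)) * ζ x ^ (2 * k + 4) ≤ C := by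
  obtain ⟨A, hA0, hA1, hA2⟩ := exists_bound_cutoff_pow hζ hζc h0 h1 k
  obtain ⟨B, hB0, hB1, -⟩ := exists_bound_cutoff_pow hζ hζc h0 h1 (2 * k)
  let K : ℝ := (2 * A ^ 2 + 4 * A * B + 10 * A) / (p - 1)
  have hp' : 0 < p - 1 := by linarith
  have hK0 : 0 ≤ K := by positivity
  let K' : ℝ := 3 * K + 8 * A * B + 24 * A + 1
  have hK'0 : 0 < K' := by positivity
  let K'' : ℝ := K' + K' ^ 2 / 2
  have hK''0 : 0 < K'' := by positivity
  obtain ⟨M, hM0, hM⟩ := exists_young_cutoff hp hk hk' (δ := 1 / (2 * K'')) (by positivity)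
  refine ⟨2 * K'' * (M * ∫ x, ζ x), fun u h => ?_⟩
  let η : EuclideanSpace ℝ (Fin N) → ℝ := fun y => ζ y ^ (k + 2)
  have hη : ContDiff ℝ 2 η := hζ.pow _
  have hηc : HasCompactSupport η := by
    simp only [η, pow_succ]; exact HasCompactSupport.mul_left hζc
  have hu := h.contDiff_two
  have hu1 := h.contDiff_one
  have hz := h.lap_contDiff
  have hG : Continuous (gradDot u u) := continuous_gradDot hu1 hu1
  have hint : ∀ {g : EuclideanSpace ℝ (Fin N) → ℝ}, Continuous g → ∀ {j : ℕ}, j ≠ 0 →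
      Integrable fun x => g x * ζ x ^ j :=
    fun hg _ hj => integrable_mul_pow_cutoff hζ.continuous hζc hg hj
  have iX := hint (h.continuous_rpow (p + 1)) (j := 2 * k + 4) (by omega)
  have iZ : Integrable fun x => lap u x ^ 2 * ζ x ^ (2 * k + 4) :=
    hint (hz.continuous.pow 2) (j := 2 * k + 4) (by omega)
  have iS : Integrable fun x => u x ^ 2 * ζ x ^ (2 * k) :=
    hint (hu.continuous.pow 2) (j := 2 * k) (by omega)
  have iT : Integrable fun x => u x * |lap u x| * ζ x ^ (2 * k + 2) :=
    hint (hu.continuous.mul hz.continuous.abs) (j := 2 * k + 2) (by omega)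
  have iG := hint hG (j := 2 * k + 2) (by omega)
  have d : ∀ x, DifferentiableAt ℝ u x := hu1.differentiable (by norm_num)
  have dη : ∀ x, DifferentiableAt ℝ η x := hη.differentiable (by norm_num)
  have huη : ContDiff ℝ 2 fun y => u y * η y := hu.mul hη
  have hL1 : ∀ x, lap (fun y => u y * η y) x =
      u x * lap η x + 2 * gradDot u η x + η x * lap u x := fun x => lap_mul hu hη
  have hL2 : ∀ x, lap (fun y => (u y * η y) * η y) x = η x ^ 2 * lap u x +
      4 * η x * gradDot u η x + 2 * u x * η x * lap η x + 2 * u x * gradDot η η x := fun x => by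
    rw [lap_mul huη hη, hL1, gradDot_mul_left (d x) (dη x)]
    ring
  have hD : ∀ x, gradDot u η x ^ 2 ≤ A * (gradDot u u x * ζ x ^ (2 * k + 2)) := fun x => by
    have a1 := gradDot_sq_le (f := u) (g := η) (x := x)
    have a2 := mul_le_mul_of_nonneg_left (hA2 x) (gradDot_self_nonneg (f := u) (x := x))
    linarith
  have hE : ∀ x, |u x * lap u x * gradDot η η x| ≤ A * (u x * |lap u x| * ζ x ^ (2 * k + 2)) :=
    fun x => by
      rw [abs_mul, abs_mul, abs_of_pos (h.pos x), abs_of_nonneg gradDot_self_nonneg]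
      have := mul_le_mul_of_nonneg_left (hA2 x) (mul_nonneg (h.pos x).le (abs_nonneg (lap u x)))
      linarith
  have hLη : ∀ x, (u x * lap η x) ^ 2 ≤ A ^ 2 * (u x ^ 2 * ζ x ^ (2 * k)) := fun x => by
    have := pow_le_pow_left₀ (abs_nonneg _) (hA1 x) 2
    rw [sq_abs] at this
    have := mul_le_mul_of_nonneg_left this (sq_nonneg (u x))
    calc _ = u x ^ 2 * lap η x ^ 2 := by ring
      _ ≤ _ := this
      _ = _ := by ring
  have hEL : ∀ x, |u x * lap u x * (η x * lap η x)| ≤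
      A * (u x * |lap u x| * ζ x ^ (2 * k + 2)) := fun x => by
    rw [abs_mul, abs_mul, abs_of_pos (h.pos x), abs_mul (η x),
      abs_of_nonneg (pow_nonneg (h0 x) (k + 2))]
    have a1 := mul_le_mul_of_nonneg_left (hA1 x) (pow_nonneg (h0 x) (k + 2))
    have := mul_le_mul_of_nonneg_left a1 (mul_nonneg (h.pos x).le (abs_nonneg (lap u x)))
    calc _ ≤ _ := this
      _ = _ := by ring
  have e : ∀ x, u x ^ (p + 1) = u x ^ p * u x := fun x => by rw [rpow_add_one (h.pos x).ne']
  have e' : ∀ x, u x ^ (p + 1) = u x ^ (p - 1) * u x ^ 2 := fun x => by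
    rw [← rpow_natCast (u x) 2, ← rpow_add (h.pos x)]; congr 1; push_cast; ring
  have hXeq : ∫ x, u x ^ (p + 1) * ζ x ^ (2 * k + 4) =
      ∫ x, lap u x * lap (fun y => (u y * η y) * η y) x := by
    rw [← integral_lap_mul_eq_mul_lap hz (huη.mul hη) hηc.mul_left]
    refine integral_congr_ae (ae_of_all _ fun x => ?_)
    simp only [h.lap_lap, e, η]
    ring
  have iL2 : Integrable fun x => lap u x * lap (fun y => (u y * η y) * η y) x :=
    (hz.continuous.mul (continuous_lap (huη.mul hη))).integrable_of_hasCompactSupport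
      (hηc.mul_left.lap.mul_left)
  have hst : p * ∫ x, u x ^ (p + 1) * ζ x ^ (2 * k + 4) ≤
      ∫ x, lap (fun y => u y * η y) x ^ 2 := by
    have := stability_C2 (w := fun x => p * u x ^ (p - 1))
      (continuous_const.mul (h.continuous_rpow _)) (fun φ hφ hφc => by
        simp only [mul_assoc, integral_const_mul]
        exact h.stable φ hφ hφc) huη hηc.mul_left
    simp only [mul_assoc, integral_const_mul] at this
    refine le_trans (le_of_eq ?_) this
    congr 1
    refine integral_congr_ae (ae_of_all _ fun x => ?_)
    simp only [e', η]
    ring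
  have hX1 : ∫ x, lap (fun y => u y * η y) x ^ 2 ≤
      ((∫ x, u x ^ (p + 1) * ζ x ^ (2 * k + 4)) +
        2 * A ^ 2 * ∫ x, u x ^ 2 * ζ x ^ (2 * k)) +
        8 * A * (∫ x, gradDot u u x * ζ x ^ (2 * k + 2)) +
        2 * A * ∫ x, u x * |lap u x| * ζ x ^ (2 * k + 2) := by
    rw [hXeq]
    rw [← one_mul (∫ x, lap u x * lap (fun y => (u y * η y) * η y) x)]
    refine integral_le_combo₄ ?_ iL2 iS iG iT _ _ _ _ fun x => ?_
    · refine ((continuous_lap huη).pow 2).integrable_of_hasCompactSupport ?_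
      simp only [sq]
      exact hηc.mul_left.lap.mul_left
    · rw [hL1, hL2]
      have a1 := hD x
      have a2 := neg_le_of_abs_le (hE x)
      have a3 := hLη x
      nlinarith [sq_nonneg (u x * lap η x - 2 * gradDot u η x)]
  have hX2 : 2⁻¹ * (∫ x, lap u x ^ 2 * ζ x ^ (2 * k + 4)) ≤
      ((∫ x, u x ^ (p + 1) * ζ x ^ (2 * k + 4)) +
        8 * A * (∫ x, gradDot u u x * ζ x ^ (2 * k + 2))) +
        4 * A * ∫ x, u x * |lap u x| * ζ x ^ (2 * k + 2) := by
    rw [hXeq]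
    rw [← integral_const_mul, ← one_mul (∫ x, lap u x * lap (fun y => (u y * η y) * η y) x)]
    refine integral_le_combo₃ (iZ.const_mul _) iL2 iG iT _ _ _ fun x => ?_
    rw [hL2]
    have a1 := hD x
    have a2 := neg_le_of_abs_le (hE x)
    have a3 := neg_le_of_abs_le (hEL x)
    have a4 : lap u x ^ 2 * ζ x ^ (2 * k + 4) = (η x * lap u x) ^ 2 := by simp only [η]; ring
    rw [a4]
    nlinarith [sq_nonneg (η x * lap u x + 4 * gradDot u η x)]
  have hG2 : 2 * (∫ x, gradDot u u x * ζ x ^ (2 * k + 2)) ≤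
      (B * ∫ x, u x ^ 2 * ζ x ^ (2 * k)) +
        2 * ∫ x, u x * |lap u x| * ζ x ^ (2 * k + 2) := by
    have hρ : ContDiff ℝ 2 fun y => ζ y ^ (2 * k + 2) := hζ.pow _
    have hρc : HasCompactSupport fun y => ζ y ^ (2 * k + 2) := by
      simp only [pow_succ]; exact HasCompactSupport.mul_left hζc
    have huu : ContDiff ℝ 2 fun y => u y * u y := hu.mul hu
    have e1 := integral_lap_mul_eq_mul_lap huu hρ hρc
    have iR : Integrable fun x => u x * u x * lap (fun y => ζ y ^ (2 * k + 2)) x :=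
      (huu.continuous.mul (continuous_lap hρ)).integrable_of_hasCompactSupport hρc.lap.mul_left
    have iR' : Integrable fun x => lap (fun y => u y * u y) x * ζ x ^ (2 * k + 2) :=
      hint (continuous_lap huu) (by omega)
    have e2 : ∫ x, u x * u x * lap (fun y => ζ y ^ (2 * k + 2)) x ≤
        B * ∫ x, u x ^ 2 * ζ x ^ (2 * k) := by
      rw [← integral_const_mul]
      refine integral_mono iR (iS.const_mul _) fun x => ?_
      have := mul_le_mul_of_nonneg_left ((le_abs_self _).trans (hB1 x)) (mul_self_nonneg (u x))
      simp only
      linarith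
    rw [← e1] at e2
    have e3 : 2 * (∫ x, gradDot u u x * ζ x ^ (2 * k + 2)) ≤
        (∫ x, lap (fun y => u y * u y) x * ζ x ^ (2 * k + 2)) +
          2 * ∫ x, u x * |lap u x| * ζ x ^ (2 * k + 2) := by
      rw [← integral_const_mul, ← one_mul (∫ x, lap (fun y => u y * u y) x * ζ x ^ (2 * k + 2))]
      refine integral_le_combo₂ (iG.const_mul _) iR' iT _ _ fun x => ?_
      rw [lap_mul hu hu]
      have a1 := mul_le_mul_of_nonneg_left (neg_abs_le (lap u x))
        (mul_nonneg (h.pos x).le (pow_nonneg (h0 x) (2 * k + 2)))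
      linarith
    linarith
  have hT : ∫ x, u x * |lap u x| * ζ x ^ (2 * k + 2) ≤
      1 / (2 * K') * (∫ x, lap u x ^ 2 * ζ x ^ (2 * k + 4)) +
        K' / 2 * ∫ x, u x ^ 2 * ζ x ^ (2 * k) := by
    refine integral_le_combo₂ iT iZ iS _ _ fun x => ?_
    have a1 := sq_nonneg (|lap u x| * ζ x ^ (k + 2) - K' * (u x * ζ x ^ k))
    have a2 : (|lap u x| * ζ x ^ (k + 2) - K' * (u x * ζ x ^ k)) ^ 2 =
        2 * K' * (1 / (2 * K') * (lap u x ^ 2 * ζ x ^ (2 * k + 4)) +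
          K' / 2 * (u x ^ 2 * ζ x ^ (2 * k)) - u x * |lap u x| * ζ x ^ (2 * k + 2)) := by
      rw [← sq_abs (lap u x)]
      field_simp
      ring
    rw [a2] at a1
    have := nonneg_of_mul_nonneg_right a1 (by positivity : 0 < 2 * K')
    linarith
  have hS : ∫ x, u x ^ 2 * ζ x ^ (2 * k) ≤
      1 / (2 * K'') * (∫ x, u x ^ (p + 1) * ζ x ^ (2 * k + 4)) + M * ∫ x, ζ x := by
    have iζ : Integrable ζ := hζ.continuous.integrable_of_hasCompactSupport hζc
    exact integral_le_combo₂ iS iX iζ _ _ fun x => hM _ _ (h.pos x) (h0 x) (h1 x)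
  have hfin : ∫ x, (lap u x ^ 2 + u x ^ (p + 1)) * ζ x ^ (2 * k + 4) =
      (∫ x, lap u x ^ 2 * ζ x ^ (2 * k + 4)) + ∫ x, u x ^ (p + 1) * ζ x ^ (2 * k + 4) := by
    rw [← integral_add iZ iX]
    simp only [add_mul]
  have hS0 : 0 ≤ ∫ x, u x ^ 2 * ζ x ^ (2 * k) :=
    integral_nonneg fun x => mul_nonneg (sq_nonneg _) (pow_nonneg (h0 x) _)
  have hT0 : 0 ≤ ∫ x, u x * |lap u x| * ζ x ^ (2 * k + 2) :=
    integral_nonneg fun x => mul_nonneg (mul_nonneg (h.pos x).le (abs_nonneg _))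
      (pow_nonneg (h0 x) _)
  rw [hfin]
  generalize (∫ x, lap u x ^ 2 * ζ x ^ (2 * k + 4)) = Z at *
  generalize (∫ x, u x ^ (p + 1) * ζ x ^ (2 * k + 4)) = X at *
  generalize (∫ x, u x ^ 2 * ζ x ^ (2 * k)) = S at *
  generalize (∫ x, u x * |lap u x| * ζ x ^ (2 * k + 2)) = T at *
  generalize (∫ x, gradDot u u x * ζ x ^ (2 * k + 2)) = G at *
  generalize (∫ x, ζ x) = I at *
  have b1 : X ≤ K * (S + T) := by
    rw [div_mul_eq_mul_div, le_div_iff₀ hp']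
    nlinarith [mul_nonneg hA0 hS0, mul_nonneg hA0 hT0, mul_nonneg (mul_nonneg hA0 hB0) hT0,
      mul_nonneg (sq_nonneg A) hT0]
  have b2 : X + Z ≤ K' * (S + T) := by
    simp only [K']
    nlinarith [mul_nonneg hA0 hS0, mul_nonneg hA0 hT0, mul_nonneg (mul_nonneg hA0 hB0) hT0]
  have b3 : K' * T ≤ Z / 2 + K' ^ 2 / 2 * S := by
    have := mul_le_mul_of_nonneg_left hT hK'0.le
    refine this.trans (le_of_eq ?_)
    field_simp
  have b4 : K'' * S ≤ X / 2 + K'' * (M * I) := by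
    have := mul_le_mul_of_nonneg_left hS hK''0.le
    refine this.trans (le_of_eq ?_)
    field_simp
  have b5 : K'' * S = K' * S + K' ^ 2 / 2 * S := by simp only [K'']; ring
  linarith

end Energy

section MeanValue

open Filter Topology

variable {N : ℕ} {p : ℝ} {u : EuclideanSpace ℝ (Fin N) → ℝ}

lemma energy_estimate (N : ℕ) (hp : 1 < p) :
    ∃ C, ∀ u : EuclideanSpace ℝ (Fin N) → ℝ, IsStableSol p u →
      ∫ x in Metric.closedBall 0 1, lap u x ^ 2 ≤ C := by
  obtain ⟨χ, hχ, hχc, h0, h1, hχe, -⟩ := exists_cutoff N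
  have hχ2 : ContDiff ℝ 2 χ := contDiff_infty.1 hχ 2
  obtain ⟨k, hk⟩ := exists_nat_ge (8 / (p - 1) + 2)
  have hp' : 0 < 8 / (p - 1) := by
    have : 0 < p - 1 := by linarith
    positivity
  have hk1 : (1 : ℝ) ≤ k := by linarith
  obtain ⟨C, hC⟩ := energy_estimate_cutoff (N := N) hp hχ2 hχc h0 h1 (k := k) (by exact_mod_cast hk1)
    (by linarith)
  refine ⟨C, fun u h => le_trans ?_ (hC u h)⟩
  have hcont : Continuous fun x => (lap u x ^ 2 + u x ^ (p + 1)) :=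
    (h.lap_contDiff.continuous.pow 2).add (h.continuous_rpow _)
  have hint := integrable_mul_pow_cutoff (j := 2 * k + 4) hχ2.continuous hχc hcont (by omega)
  refine le_trans ?_ (setIntegral_le_integral (s := Metric.closedBall 0 1) hint
    (ae_of_all _ fun x => ?_))
  · refine setIntegral_mono_on ((h.lap_contDiff.continuous.pow 2).continuousOn.integrableOn_compact
      (isCompact_closedBall 0 1)) hint.integrableOn Metric.isClosed_closedBall.measurableSet
      fun x hx => ?_
    rw [hχe x (by simpa using hx), one_pow, mul_one]
    linarith [rpow_nonneg (h.pos x).le (p + 1)]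
  · have := rpow_nonneg (h.pos x).le (p + 1)
    exact mul_nonneg (by positivity) (pow_nonneg (h0 x) _)

lemma hasDerivAt_max_zero_sq (t : ℝ) : HasDerivAt (fun s : ℝ => max 0 s ^ 2) (2 * max 0 t) t := by
  rcases lt_trichotomy t 0 with h | rfl | h
  · rw [max_eq_left h.le, mul_zero]
    refine (hasDerivAt_const t (0 : ℝ)).congr_of_eventuallyEq ?_
    filter_upwards [eventually_lt_nhds h] with s hs
    rw [max_eq_left hs.le]; norm_num
  · have : HasFDerivAt (fun s : ℝ => max 0 s ^ 2) (0 : ℝ →L[ℝ] ℝ) 0 := by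
      refine Asymptotics.IsBigO.hasFDerivAt (n := 2) (Asymptotics.isBigO_of_le _ fun s => ?_)
        (by norm_num)
      simp only [sub_zero, norm_pow, norm_norm]
      refine pow_le_pow_left₀ (norm_nonneg _) ?_ 2
      rw [Real.norm_of_nonneg (le_max_left _ _)]
      exact max_le (norm_nonneg _) (le_abs_self s)
    simpa using this.hasDerivAt
  · rw [max_eq_right h.le]
    have := hasDerivAt_pow 2 t
    simp only [Nat.cast_ofNat, Nat.add_one_sub_one, pow_one] at this
    refine this.congr_of_eventuallyEq ?_
    filter_upwards [eventually_gt_nhds h] with s hs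
    rw [max_eq_right hs.le]

lemma pd_norm_sq (i : Fin N) (x : EuclideanSpace ℝ (Fin N)) :
    pd i (fun y => ‖y‖ ^ 2) x = 2 * x i := by
  simp only [pd]
  rw [(hasStrictFDerivAt_norm_sq x).hasFDerivAt.fderiv]
  simp [EuclideanSpace.inner_single_right]

lemma clm_apply_eq_sum (A : EuclideanSpace ℝ (Fin N) →L[ℝ] ℝ) (y : EuclideanSpace ℝ (Fin N)) :
    A y = ∑ i, y i * A (EuclideanSpace.single i 1) := by
  calc A y = A (∑ i, y i • EuclideanSpace.single i (1 : ℝ)) := by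
        congr 1
        simpa using ((EuclideanSpace.basisFun (Fin N) ℝ).sum_repr y).symm
    _ = _ := by simp

/-- A weighted mean value inequality for subharmonic functions. -/
lemma mean_value_of_subharmonic {z : EuclideanSpace ℝ (Fin N) → ℝ} (hz : ContDiff ℝ 2 z)
    (hsub : ∀ x, 0 ≤ lap z x) :
    z 0 * ∫ y : EuclideanSpace ℝ (Fin N), max 0 (1 - ‖y‖ ^ 2) ≤
      ∫ y, z y * max 0 (1 - ‖y‖ ^ 2) := by
  let ψ : EuclideanSpace ℝ (Fin N) → ℝ := fun y => max 0 (1 - ‖y‖ ^ 2)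
  let Ψ : EuclideanSpace ℝ (Fin N) → ℝ := fun y => max 0 (1 - ‖y‖ ^ 2) ^ 2
  have hψ : Continuous ψ := by fun_prop
  have hψ0 : ∀ y, 0 ≤ ψ y := fun y => le_max_left _ _
  have hψz : ∀ y, y ∉ Metric.closedBall (0 : EuclideanSpace ℝ (Fin N)) 1 → ψ y = 0 := fun y hy => by
    have : 1 < ‖y‖ := by simpa using hy
    exact max_eq_left (by nlinarith)
  have hψc : HasCompactSupport ψ := HasCompactSupport.intro (isCompact_closedBall 0 1) hψz
  have hΨc : HasCompactSupport Ψ := by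
    simp only [Ψ, sq (max _ _)]; exact HasCompactSupport.mul_left hψc
  have hΨ : ContDiff ℝ 1 Ψ := by
    have hk : ContDiff ℝ 1 (fun s : ℝ => max 0 s ^ 2) := by
      rw [contDiff_one_iff_deriv]
      refine ⟨fun t => (hasDerivAt_max_zero_sq t).differentiableAt, ?_⟩
      rw [funext fun t => (hasDerivAt_max_zero_sq t).deriv]
      fun_prop
    exact hk.comp (contDiff_const.sub (contDiff_norm_sq ℝ))
  have hpd : ∀ i y, pd i Ψ y = -4 * y i * ψ y := fun i y => by
    have h1 : DifferentiableAt ℝ (fun y : EuclideanSpace ℝ (Fin N) => ‖y‖ ^ 2) y :=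
      (contDiff_norm_sq ℝ (n := 1)).differentiable (by norm_num) y
    have h2 := pd_comp (i := i) (f := fun y : EuclideanSpace ℝ (Fin N) => 1 - ‖y‖ ^ 2)
      (hasDerivAt_max_zero_sq (1 - ‖y‖ ^ 2)) (h1.const_sub 1)
    rw [pd_sub (differentiableAt_const _) h1, pd_norm_sq] at h2
    have h3 : pd i (fun _ : EuclideanSpace ℝ (Fin N) => (1 : ℝ)) y = 0 := by simp [pd]
    rw [h3] at h2
    exact h2.trans (by simp only [ψ]; ring)
  have hz1 : ContDiff ℝ 1 z := hz.of_le (by norm_num)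
  let F' : ℝ → EuclideanSpace ℝ (Fin N) → ℝ := fun t y => fderiv ℝ z (t • y) y * ψ y
  have hF'c : Continuous fun q : ℝ × EuclideanSpace ℝ (Fin N) => F' q.1 q.2 := by
    have := hz1.continuous_fderiv (by norm_num)
    exact (((this.comp (by fun_prop : Continuous fun q : ℝ × EuclideanSpace ℝ (Fin N) =>
      q.1 • q.2)).clm_apply continuous_snd).mul (hψ.comp continuous_snd))
  have hder : ∀ t, HasDerivAt (fun t : ℝ => ∫ y, z (t • y) * ψ y) (∫ y, F' t y) t := by
    intro t
    obtain ⟨M, hM⟩ := ((isCompact_Icc (a := t - 1) (b := t + 1)).prod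
      (isCompact_closedBall (0 : EuclideanSpace ℝ (Fin N)) 1)).exists_bound_of_continuousOn
        hF'c.continuousOn
    refine (hasDerivAt_integral_of_dominated_loc_of_deriv_le
      (bound := Set.indicator (Metric.closedBall 0 1) fun _ => M)
      (Icc_mem_nhds (by linarith : t - 1 < t) (by linarith : t < t + 1)) (Eventually.of_forall fun s => ?_) ?_
      ?_ (ae_of_all _ fun y s hs => ?_) ?_ (ae_of_all _ fun y s _ => ?_)).2
    · exact ((hz.continuous.comp (by fun_prop : Continuous fun y => s • y)).mul
        hψ).aestronglyMeasurable
    · exact ((hz.continuous.comp (by fun_prop : Continuous fun y => t • y)).mul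
        hψ).integrable_of_hasCompactSupport hψc.mul_left
    · exact (hF'c.comp (by fun_prop : Continuous fun y => (t, y))).aestronglyMeasurable
    · by_cases hy : y ∈ Metric.closedBall (0 : EuclideanSpace ℝ (Fin N)) 1
      · rw [Set.indicator_of_mem hy]
        exact hM (s, y) ⟨hs, hy⟩
      · simp [Set.indicator_of_notMem hy, F', hψz y hy]
    · rw [integrable_indicator_iff Metric.isClosed_closedBall.measurableSet]
      exact continuousOn_const.integrableOn_compact (isCompact_closedBall 0 1)
    · have h1 : HasDerivAt (fun s : ℝ => s • y) y s := by
        simpa using (hasDerivAt_id s).smul_const y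
      exact (((hz1.differentiable (by norm_num) (s • y)).hasFDerivAt.comp_hasDerivAt s
        h1)).mul_const _
  have hF'eq : ∀ t, ∫ y, F' t y = 4⁻¹ * (t * ∫ y, lap z (t • y) * Ψ y) := by
    intro t
    have e1 : ∀ y, F' t y = -4⁻¹ * ∑ i, pd i z (t • y) * pd i Ψ y := fun y => by
      have : fderiv ℝ z (t • y) y = ∑ i, y i * pd i z (t • y) := clm_apply_eq_sum _ y
      simp only [F', this, hpd, Finset.sum_mul, Finset.mul_sum]
      exact Finset.sum_congr rfl fun i _ => by ring
    have hc : ∀ i, ContDiff ℝ 1 fun y => pd i z (t • y) := fun i =>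
      (hz.pd_one i).comp (by fun_prop)
    have e2 : ∀ i, ∫ y, pd i z (t • y) * pd i Ψ y =
        -(t * ∫ y, pd i (pd i z) (t • y) * Ψ y) := fun i => by
      rw [integral_mul_pd (hc i) hΨ hΨc i, ← integral_const_mul]
      congr 1
      refine integral_congr_ae (ae_of_all _ fun y => ?_)
      have := pd_comp_affine ((hz.pd_one i).differentiable (by norm_num)) 0 t i y
      simp only [zero_add] at this
      simp only [this, mul_assoc]
    simp only [e1, integral_const_mul]
    have hint : ∀ i ∈ Finset.univ, Integrable fun y => pd i z (t • y) * pd i Ψ y := fun i _ =>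
      ((hc i).continuous.mul (continuous_pd hΨ i)).integrable_of_hasCompactSupport
        (hΨc.pd i).mul_left
    rw [integral_finsetSum _ hint]
    simp only [e2, lap_eq_sum_pd, Finset.sum_mul]
    rw [integral_finsetSum]
    · rw [Finset.mul_sum, Finset.mul_sum, Finset.mul_sum]
      exact Finset.sum_congr rfl fun i _ => by ring
    · intro i _
      exact (((contDiff_pd (m := 0) (n := 1) (hz.pd_one i) (by norm_num) i).continuous.comp
        (by fun_prop : Continuous fun y => t • y)).mul
          hΨ.continuous).integrable_of_hasCompactSupport hΨc.mul_left
  have hmono : MonotoneOn (fun t : ℝ => ∫ y, z (t • y) * ψ y) (Set.Icc 0 1) := by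
    refine monotoneOn_of_hasDerivWithinAt_nonneg (convex_Icc 0 1)
      (fun t _ => (hder t).continuousAt.continuousWithinAt)
      (fun t _ => (hder t).hasDerivWithinAt) fun t ht => ?_
    rw [interior_Icc] at ht
    rw [hF'eq]
    have : 0 ≤ ∫ y, lap z (t • y) * Ψ y :=
      integral_nonneg fun y => mul_nonneg (hsub _) (sq_nonneg _)
    have := mul_nonneg ht.1.le this
    positivity
  have h01 := hmono (Set.left_mem_Icc.2 zero_le_one) (Set.right_mem_Icc.2 zero_le_one) zero_le_one
  simpa only [zero_smul, one_smul, integral_const_mul] using h01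

/-- A stable solution is superharmonic. -/
lemma IsStableSol.lap_nonpos (hp : 1 < p) (h : IsStableSol p u)
    (a : EuclideanSpace ℝ (Fin N)) : lap u a ≤ 0 := by
  obtain ⟨C, hC⟩ := energy_estimate N hp
  let ψ : EuclideanSpace ℝ (Fin N) → ℝ := fun y => max 0 (1 - ‖y‖ ^ 2)
  have hψ : Continuous ψ := by fun_prop
  have hψ0 : ∀ y, 0 ≤ ψ y := fun y => le_max_left _ _
  have hψz : ∀ y, y ∉ Metric.closedBall (0 : EuclideanSpace ℝ (Fin N)) 1 → ψ y = 0 := fun y hy => by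
    have : 1 < ‖y‖ := by simpa using hy
    exact max_eq_left (by nlinarith)
  have hψc : HasCompactSupport ψ := HasCompactSupport.intro (isCompact_closedBall 0 1) hψz
  have hpos : 0 < ∫ y, ψ y :=
    hψ.integral_pos_of_hasCompactSupport_nonneg_nonzero hψc hψ0 (x := 0) (by simp [ψ])
  let V : ℝ := ∫ _ in Metric.closedBall (0 : EuclideanSpace ℝ (Fin N)) 1, (1 : ℝ)
  have key : ∀ w : EuclideanSpace ℝ (Fin N) → ℝ, IsStableSol p w →
      lap w 0 * ∫ y, ψ y ≤ V + C := by
    intro w hw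
    have h1 := mean_value_of_subharmonic hw.lap_contDiff fun x => by
      rw [hw.lap_lap]; exact rpow_nonneg (hw.pos x).le _
    refine h1.trans ?_
    have h2 : ∫ y, lap w y * ψ y = ∫ y in Metric.closedBall 0 1, lap w y * ψ y := by
      rw [setIntegral_eq_integral_of_forall_compl_eq_zero]
      intro y hy
      rw [hψz y hy, mul_zero]
    change ∫ y, lap w y * ψ y ≤ _
    rw [h2]
    have i1 := (hw.lap_contDiff.continuous.pow 2).continuousOn.integrableOn_compact (μ := volume)
      (isCompact_closedBall (0 : EuclideanSpace ℝ (Fin N)) 1)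
    have i2 : IntegrableOn (fun _ => (1 : ℝ)) (Metric.closedBall (0 : EuclideanSpace ℝ (Fin N)) 1) :=
      continuousOn_const.integrableOn_compact (isCompact_closedBall 0 1)
    have i3 := (hw.lap_contDiff.continuous.mul hψ).continuousOn.integrableOn_compact (μ := volume)
      (isCompact_closedBall (0 : EuclideanSpace ℝ (Fin N)) 1)
    have h3 := integral_le_combo₂ i3 i2 i1 1 1 (fun y => by
      have : ψ y ≤ 1 := max_le zero_le_one (by nlinarith [norm_nonneg y])
      have := hψ0 y
      simp only [Pi.mul_apply, Pi.pow_apply]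
      nlinarith [sq_nonneg (lap w y - 1), sq_nonneg (lap w y + 1)])
    rw [one_mul, one_mul] at h3
    exact h3.trans (by simpa [V] using hC w hw)
  by_contra hneg
  push Not at hneg
  have hp' : 0 < p - 1 := by linarith
  let R : ℝ := (|V + C| + 1) / (lap u a * ∫ y, ψ y) + 1
  have hd : 0 < lap u a * ∫ y, ψ y := mul_pos hneg hpos
  have hR : 1 ≤ R := by
    have : 0 ≤ (|V + C| + 1) / (lap u a * ∫ y, ψ y) := by positivity
    simp only [R]; linarith
  have h1 := key _ (h.rescale hp a (zero_lt_one.trans_le hR))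
  rw [lap_rescale h.contDiff_two] at h1
  simp only [smul_zero, add_zero] at h1
  have h2 : R ≤ R ^ (4 / (p - 1)) * R ^ 2 := by
    have a1 : 1 ≤ R ^ (4 / (p - 1)) := one_le_rpow hR (by positivity)
    nlinarith
  have h3 := mul_le_mul_of_nonneg_right h2 hd.le
  have h4 : R * (lap u a * ∫ y, ψ y) = |V + C| + 1 + lap u a * ∫ y, ψ y := by
    simp only [R]; field_simp
  linarith [le_abs_self (V + C)]

end MeanValue

section KellerOsserman

open Filter Topology

variable {N : ℕ} {f w : EuclideanSpace ℝ (Fin N) → ℝ} {x : EuclideanSpace ℝ (Fin N)}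

lemma hasDerivAt_line (hf : Differentiable ℝ f) (i : Fin N) (x : EuclideanSpace ℝ (Fin N)) (t : ℝ) :
    HasDerivAt (fun t : ℝ => f (x + t • EuclideanSpace.single i 1))
      (pd i f (x + t • EuclideanSpace.single i 1)) t := by
  have h1 : HasDerivAt (fun t : ℝ => x + t • EuclideanSpace.single i (1 : ℝ))
      (EuclideanSpace.single i 1) t := by
    simpa using ((hasDerivAt_id t).smul_const (EuclideanSpace.single i (1 : ℝ))).const_add x
  exact (hf _).hasFDerivAt.comp_hasDerivAt t h1

/-- The Laplacian is nonpositive at a local maximum. -/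
lemma lap_nonpos_of_isLocalMax (hf : ContDiff ℝ 2 f) (h : IsLocalMax f x) : lap f x ≤ 0 := by
  rw [lap_eq_sum_pd]
  refine Finset.sum_nonpos fun i _ => ?_
  by_contra hpos
  push Not at hpos
  let g : ℝ → ℝ := fun t => f (x + t • EuclideanSpace.single i 1)
  have hd : ∀ t, HasDerivAt g (pd i f (x + t • EuclideanSpace.single i 1)) t :=
    hasDerivAt_line (hf.differentiable (by norm_num)) i x
  have hdg : deriv g = fun t => pd i f (x + t • EuclideanSpace.single i 1) :=
    funext fun t => (hd t).deriv
  have hdd : deriv (deriv g) 0 = pd i (pd i f) x := by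
    rw [hdg, (hasDerivAt_line ((hf.pd_one i).differentiable (by norm_num)) i x 0).deriv]
    simp
  have hmax : IsLocalMax g 0 := by
    have hc : ContinuousAt (fun t : ℝ => x + t • EuclideanSpace.single i (1 : ℝ)) 0 := by fun_prop
    have h2 : Tendsto (fun t : ℝ => x + t • EuclideanSpace.single i (1 : ℝ)) (𝓝 0) (𝓝 x) := by
      simpa [ContinuousAt] using hc
    simpa [IsLocalMax, IsMaxFilter, g] using h2.eventually h
  have hmin : IsLocalMin g 0 :=
    isLocalMin_of_deriv_deriv_pos (hdd ▸ hpos) hmax.deriv_eq_zero (hd 0).continuousAt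
  have hconst : g =ᶠ[𝓝 0] fun _ => g 0 := by
    filter_upwards [hmax, hmin] with t h1 h2 using le_antisymm h1 h2
  have h3 := hconst.deriv.deriv_eq
  rw [hdd, deriv_const', deriv_const] at h3
  linarith

lemma pd_eq_zero_of_isLocalMax (h : IsLocalMax f x) (i : Fin N) : pd i f x = 0 := by
  simp [pd, h.fderiv_eq_zero]

lemma contDiff_one_sub_norm_sq {n : WithTop ℕ∞} :
    ContDiff ℝ n fun y : EuclideanSpace ℝ (Fin N) => 1 - ‖y‖ ^ 2 :=
  contDiff_const.sub (contDiff_norm_sq ℝ)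

lemma pd_one_sub_norm_sq (i : Fin N) (x : EuclideanSpace ℝ (Fin N)) :
    pd i (fun y => 1 - ‖y‖ ^ 2) x = -2 * x i := by
  have h1 : DifferentiableAt ℝ (fun y : EuclideanSpace ℝ (Fin N) => ‖y‖ ^ 2) x :=
    (contDiff_norm_sq ℝ (n := 1)).differentiable (by norm_num) x
  rw [pd_sub (differentiableAt_const _) h1, pd_norm_sq]
  simp [pd]

lemma gradDot_one_sub_norm_sq (x : EuclideanSpace ℝ (Fin N)) :
    gradDot (fun y => 1 - ‖y‖ ^ 2) (fun y => 1 - ‖y‖ ^ 2) x = 4 * ‖x‖ ^ 2 := by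
  simp only [gradDot, pd_one_sub_norm_sq]
  rw [EuclideanSpace.real_norm_sq_eq, Finset.mul_sum]
  exact Finset.sum_congr rfl fun i _ => by ring

lemma lap_one_sub_norm_sq (x : EuclideanSpace ℝ (Fin N)) :
    lap (fun y => 1 - ‖y‖ ^ 2) x = -2 * N := by
  have h : ∀ i : Fin N, pd i (pd i fun y : EuclideanSpace ℝ (Fin N) => 1 - ‖y‖ ^ 2) x = -2 := by
    intro i
    rw [show (pd i fun y : EuclideanSpace ℝ (Fin N) => 1 - ‖y‖ ^ 2) = fun y => -2 * y i from
      funext fun y => pd_one_sub_norm_sq i y]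
    have hd : DifferentiableAt ℝ (fun y : EuclideanSpace ℝ (Fin N) => y i) x := by fun_prop
    rw [pd_const_mul _ hd]
    have : (fun y : EuclideanSpace ℝ (Fin N) => y i) = EuclideanSpace.proj (𝕜 := ℝ) i := rfl
    rw [pd, this, ContinuousLinearMap.fderiv]
    simp
  simp only [lap_eq_sum_pd, h]
  simp [mul_comm]

/-- A local Keller–Osserman bound. -/
lemma keller_osserman_local {c m : ℝ} {n : ℕ} (hc : 0 < c) (hm : 1 < m) (hn2 : 2 ≤ n)
    (hn : 2 ≤ n * (m - 1))
    (hw : ContDiff ℝ 2 w) (h : ∀ x, 0 < w x → c * w x ^ m ≤ lap w x) (h0 : 0 < w 0) :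
    w 0 ^ (m - 1) ≤ (4 * n * (n + 1) + 2 * n * N) / c := by
  let d : EuclideanSpace ℝ (Fin N) → ℝ := fun y => 1 - ‖y‖ ^ 2
  have hd : ContDiff ℝ 2 d := contDiff_one_sub_norm_sq
  let f : EuclideanSpace ℝ (Fin N) → ℝ := fun y => w y * d y ^ n
  have hn0 : n ≠ 0 := by omega
  have hf : ContDiff ℝ 2 f := hw.mul (hd.pow n)
  obtain ⟨x, hx, hmax⟩ := (isCompact_closedBall (0 : EuclideanSpace ℝ (Fin N)) 1).exists_isMaxOn
    ⟨0, by simp⟩ hf.continuous.continuousOn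
  have hf0 : f 0 = w 0 := by simp [f, d]
  have hfx : w 0 ≤ f x := hf0 ▸ hmax (by simp : (0 : EuclideanSpace ℝ (Fin N)) ∈ _)
  have hx1 : ‖x‖ < 1 := by
    refine lt_of_le_of_ne (by simpa using hx) fun h1 => ?_
    have : f x = 0 := by simp [f, d, h1, hn0]
    linarith
  have hdx : 0 < d x := by
    have := norm_nonneg x
    simp only [d]; nlinarith
  have hdx1 : d x ≤ 1 := by simp only [d]; nlinarith [norm_nonneg x]
  have hwx : 0 < w x := by
    by_contra hneg
    push Not at hneg
    have : f x ≤ 0 := mul_nonpos_of_nonpos_of_nonneg hneg (by positivity)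
    linarith
  have hloc : IsLocalMax f x :=
    hmax.isLocalMax (Metric.closedBall_mem_nhds_of_mem (by simpa using hx1))
  have dw := hw.differentiable (by norm_num) x
  have dd := hd.differentiable (by norm_num) x
  have hpd : ∀ i, d x * pd i w x = -(n * w x * pd i d x) := fun i => by
    have h1 := pd_eq_zero_of_isLocalMax hloc i
    rw [show f = fun y => w y * d y ^ n from rfl, pd_mul dw (dd.fun_pow n), pd_pow n dd] at h1
    have h2 : d x ^ n = d x ^ (n - 1) * d x := by
      rw [← pow_succ, Nat.sub_add_cancel (Nat.one_le_iff_ne_zero.2 hn0)]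
    rw [h2] at h1
    have h3 : d x ^ (n - 1) * (n * w x * pd i d x + d x * pd i w x) = 0 := by
      linear_combination h1
    have := (mul_eq_zero.1 h3).resolve_left (pow_pos hdx _).ne'
    linarith
  have hgd : d x * gradDot w d x = -(n * w x * gradDot d d x) := by
    simp only [gradDot, Finset.mul_sum, ← Finset.sum_neg_distrib]
    exact Finset.sum_congr rfl fun i _ => by linear_combination pd i d x * hpd i
  have hlap := lap_nonpos_of_isLocalMax hf hloc
  rw [show f = fun y => w y * d y ^ n from rfl, lap_mul hw (hd.pow n), lap_pow n hd,
    gradDot_pow_right n dd] at hlap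
  have hL : lap d x = -2 * N := lap_one_sub_norm_sq x
  have hG : gradDot d d x = 4 * ‖x‖ ^ 2 := gradDot_one_sub_norm_sq x
  have hG4 : gradDot d d x ≤ 4 := by rw [hG]; nlinarith [norm_nonneg x]
  have hwm : w x ^ m = w x ^ (m - 1) * w x := by
    rw [← rpow_add_one hwx.ne', sub_add_cancel]
  have hmain : d x ^ 2 * lap w x ≤ w x * (4 * n * (n + 1) + 2 * n * N) := by
    obtain ⟨k, rfl⟩ : ∃ k, n = k + 2 := ⟨n - 2, by omega⟩
    simp only [Nat.add_sub_cancel, show k + 2 - 1 = k + 1 by omega] at hlap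
    have h1 : d x ^ k * (d x ^ 2 * lap w x - w x * ((k + 2 : ℕ) * (2 * N) * d x
        + (k + 2 : ℕ) * ((k + 2 : ℕ) + 1) * gradDot d d x)) ≤ 0 := by
      rw [hL] at hlap
      refine le_of_eq_of_le ?_ hlap
      push_cast at hgd ⊢
      linear_combination -2 * (k + 2 : ℝ) * d x ^ k * hgd
    have h2 := nonpos_of_mul_nonpos_right h1 (pow_pos hdx k)
    have h3 : ((k + 2 : ℕ) : ℝ) * (2 * N) * d x ≤ (k + 2 : ℕ) * (2 * N) * 1 := by gcongr
    have h4 : ((k + 2 : ℕ) : ℝ) * ((k + 2 : ℕ) + 1) * gradDot d d x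
        ≤ (k + 2 : ℕ) * ((k + 2 : ℕ) + 1) * 4 := by gcongr
    have h5 := mul_le_mul_of_nonneg_left (add_le_add h3 h4) hwx.le
    linarith
  have hw2 : w x ^ (m - 1) * d x ^ 2 ≤ (4 * n * (n + 1) + 2 * n * N) / c := by
    rw [le_div_iff₀ hc]
    have h1 := mul_le_mul_of_nonneg_left (h x hwx) (sq_nonneg (d x))
    rw [hwm] at h1
    refine le_of_mul_le_mul_left ?_ hwx
    linarith
  refine le_trans ?_ hw2
  calc w 0 ^ (m - 1) ≤ (w x * d x ^ n) ^ (m - 1) := by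
        exact rpow_le_rpow h0.le hfx (by linarith)
    _ = w x ^ (m - 1) * d x ^ (n * (m - 1)) := by
        rw [mul_rpow hwx.le (by positivity), ← rpow_natCast, ← rpow_mul hdx.le]
    _ ≤ w x ^ (m - 1) * d x ^ (2 : ℝ) := by
        gcongr ?_ * ?_
        exact rpow_le_rpow_of_exponent_ge hdx hdx1 hn
    _ = _ := by norm_num

/-- Keller–Osserman: entire subsolutions of `Δw = c w^m`, `m > 1`, are nonpositive. -/
lemma nonpos_of_rpow_le_lap {c m : ℝ} (hc : 0 < c) (hm : 1 < m)
    (hw : ContDiff ℝ 2 w) (h : ∀ x, 0 < w x → c * w x ^ m ≤ lap w x)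
    (a : EuclideanSpace ℝ (Fin N)) : w a ≤ 0 := by
  by_contra hneg
  push Not at hneg
  have hm' : 0 < m - 1 := by linarith
  obtain ⟨n, hn⟩ := exists_nat_ge (2 / (m - 1) + 2)
  have hn2 : 2 ≤ n := by
    have : 0 < 2 / (m - 1) := by positivity
    exact_mod_cast (by linarith : (2 : ℝ) ≤ n)
  have hn' : 2 ≤ n * (m - 1) := by
    rw [← div_le_iff₀ hm']; linarith
  let K : ℝ := (4 * n * (n + 1) + 2 * n * N) / c
  have key : ∀ R : ℝ, 0 < R → R ^ 2 * w a ^ (m - 1) ≤ K := by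
    intro R hR
    have e1 : (R ^ (2 / (m - 1))) ^ (m - 1) = R ^ 2 := by
      rw [← rpow_mul hR.le, div_mul_cancel₀ _ hm'.ne']; norm_num
    have hR' : 0 < R ^ (2 / (m - 1)) := by positivity
    have h1 := keller_osserman_local (w := fun x => R ^ (2 / (m - 1)) * w (a + R • x)) (n := n)
      hc hm hn2 hn' (contDiff_const.mul (hw.comp (by fun_prop))) (fun x hx => ?_)
      (by simpa using mul_pos hR' hneg)
    · simp only [smul_zero, add_zero] at h1
      rwa [mul_rpow hR'.le hneg.le, e1] at h1
    · have hx' : 0 < w (a + R • x) := (mul_pos_iff_of_pos_left hR').1 hx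
      rw [lap_const_mul (f := fun x => w (a + R • x)) _ (hw.comp (by fun_prop)),
        lap_comp_affine hw, mul_rpow hR'.le hx'.le]
      have e2 : (R ^ (2 / (m - 1))) ^ m = R ^ (2 / (m - 1)) * R ^ 2 := by
        rw [← e1, ← rpow_one_add' hR'.le (by linarith)]; ring_nf
      rw [e2]
      have := mul_le_mul_of_nonneg_left (h _ hx') (mul_pos hR' (pow_pos hR 2)).le
      linarith
  have hw' : 0 < w a ^ (m - 1) := rpow_pos_of_pos hneg _
  have hK : 0 ≤ K := by positivity
  have h1 := key ((K + 1) / w a ^ (m - 1) + 1) (by positivity)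
  have h2 : (K + 1) / w a ^ (m - 1) ≤ ((K + 1) / w a ^ (m - 1) + 1) ^ 2 := by
    have : 0 ≤ (K + 1) / w a ^ (m - 1) := by positivity
    nlinarith
  have h3 := mul_le_mul_of_nonneg_right h2 hw'.le
  rw [div_mul_cancel₀ _ hw'.ne'] at h3
  linarith

end KellerOsserman

section Souplet

variable {N : ℕ} {p : ℝ} {u : EuclideanSpace ℝ (Fin N) → ℝ}

/-- Souplet's pointwise inequality. -/
lemma IsStableSol.souplet (hp : 1 < p) (h : IsStableSol p u) (x : EuclideanSpace ℝ (Fin N)) :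
    √(2 / (p + 1)) * u x ^ ((p + 1) / 2) ≤ -lap u x := by
  let σ : ℝ := (p + 1) / 2
  let l : ℝ := √(2 / (p + 1))
  have hσ : 1 < σ := by simp only [σ]; linarith
  have hl : 0 < l := by simp only [l]; positivity
  have hlσ : l * σ = l⁻¹ := by
    refine eq_inv_of_mul_eq_one_left ?_
    have : l ^ 2 = 2 / (p + 1) := sq_sqrt (by positivity)
    have h2 : l * σ * l = l ^ 2 * σ := by ring
    rw [h2, this]; simp only [σ]; field_simp
  have huσ : ContDiff ℝ 2 fun y => u y ^ σ := h.contDiff_two.rpow_const_of_ne fun y => (h.pos y).ne'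
  let w : EuclideanSpace ℝ (Fin N) → ℝ := fun y => l * u y ^ σ - -lap u y
  have hw : ContDiff ℝ 2 w := (contDiff_const.mul huσ).sub h.lap_contDiff.neg
  have hlapw : ∀ y, l⁻¹ * u y ^ (σ - 1) * w y ≤ lap w y := by
    intro y
    have hu := h.pos y
    have e1 : lap w y = l * lap (fun y => u y ^ σ) y - -lap (lap u) y := by
      rw [show w = fun y => (fun y => l * u y ^ σ) y - (fun y => -lap u y) y from rfl,
        lap_sub (contDiff_const.mul huσ) h.lap_contDiff.neg, lap_const_mul _ huσ, lap_neg]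
    have e2 : u y ^ p = u y ^ (σ - 1) * u y ^ σ := by
      rw [← rpow_add hu]; congr 1; simp only [σ]; ring
    rw [e1, lap_rpow σ h.contDiff_two hu, h.lap_lap, e2]
    have g0 : 0 ≤ l * (σ * (σ - 1) * u y ^ (σ - 2) * gradDot u u y) := by
      have := gradDot_self_nonneg (f := u) (x := y)
      have : 0 < σ - 1 := by linarith
      positivity
    have e3 : l⁻¹ * u y ^ (σ - 1) * w y
        = u y ^ (σ - 1) * u y ^ σ + l * σ * u y ^ (σ - 1) * lap u y := by
      rw [hlσ]; simp only [w]; field_simp; ring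
    rw [e3]; linarith
  let c : ℝ := l⁻¹ * l⁻¹ ^ ((σ - 1) / σ)
  have hfin := nonpos_of_rpow_le_lap (w := w) (c := c) (m := 1 + (σ - 1) / σ) (by positivity)
    (by have : 0 < (σ - 1) / σ := div_pos (by linarith) (by linarith)
        linarith) hw (fun y hy => ?_) x
  · simp only [w, l, σ] at hfin ⊢; linarith
  · refine le_trans ?_ (hlapw y)
    have hu := h.pos y
    have hwle : w y ≤ l * u y ^ σ := by
      have := h.lap_nonpos hp y
      simp only [w]; linarith
    have h1 : (l⁻¹ * w y) ^ ((σ - 1) / σ) ≤ u y ^ (σ - 1) := by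
      have h2 : l⁻¹ * w y ≤ u y ^ σ := by
        rw [inv_mul_le_iff₀ hl]; exact hwle
      calc _ ≤ (u y ^ σ) ^ ((σ - 1) / σ) :=
            rpow_le_rpow (by positivity) h2 (div_nonneg (by linarith) (by linarith))
        _ = _ := by rw [← rpow_mul hu.le, mul_div_cancel₀ _ (by linarith)]
    rw [mul_rpow (by positivity) hy.le] at h1
    have h3 : w y ^ (1 + (σ - 1) / σ) = w y * w y ^ ((σ - 1) / σ) := by
      rw [rpow_add hy, rpow_one]
    rw [h3]
    have := mul_le_mul_of_nonneg_left h1 (mul_pos (inv_pos.2 hl) hy).le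
    simp only [c]
    linarith

lemma IsStableSol.neg_lap_pos (hp : 1 < p) (h : IsStableSol p u) (x : EuclideanSpace ℝ (Fin N)) :
    0 < -lap u x := by
  refine lt_of_lt_of_le ?_ (h.souplet hp x)
  have := h.pos x
  positivity

end Souplet

section Bootstrap

variable {N : ℕ} {p : ℝ} {u : EuclideanSpace ℝ (Fin N) → ℝ}

/-- An energy inequality for powers of a positive function, localized by a cutoff function. -/
lemma exists_integral_gradDot_rpow_mul_le {η : EuclideanSpace ℝ (Fin N) → ℝ}
    (hη : ContDiff ℝ 2 η) (hηc : HasCompactSupport η) (hη2 : ∀ x, 2 ≤ ‖x‖ → η x = 0)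
    {a : ℝ} (ha : 1 / 2 < a) :
    ∃ M, 0 ≤ M ∧ ∀ w : EuclideanSpace ℝ (Fin N) → ℝ, ContDiff ℝ 2 w → (∀ x, 0 < w x) →
      ∫ x, gradDot (fun y => w y ^ a * η y) (fun y => w y ^ a * η y) x ≤
        a ^ 2 / (2 * a - 1) * (∫ x, w x ^ (2 * a - 1) * (-lap w x) * η x ^ 2) +
          M * ∫ x in Metric.closedBall 0 2, w x ^ (2 * a) := by
  let α : ℝ := a ^ 2 / (2 * a - 1)
  let β : ℝ := (a - α) / (2 * a)
  have hα : α * (2 * a - 1) = a ^ 2 := div_mul_cancel₀ _ (by linarith)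
  have hβ : β * (2 * a) = a - α := div_mul_cancel₀ _ (by linarith)
  have hη1 : ContDiff ℝ 1 η := hη.of_le (by norm_num)
  have hηs : ContDiff ℝ 2 fun y => η y ^ 2 := hη.pow 2
  have hηsc : HasCompactSupport fun y => η y ^ 2 := by
    simp only [sq]; exact HasCompactSupport.mul_left hηc
  let K : EuclideanSpace ℝ (Fin N) → ℝ := fun x => gradDot η η x - β * lap (fun y => η y ^ 2) x
  have hK : Continuous K :=
    (continuous_gradDot hη1 hη1).sub (continuous_const.mul (continuous_lap hηs))
  have hKc : HasCompactSupport K := hηc.gradDot_right.sub hηsc.lap.mul_left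
  have hts : tsupport η ⊆ Metric.closedBall 0 2 := by
    refine closure_minimal (fun x hx => ?_) Metric.isClosed_closedBall
    by_contra h
    exact hx (hη2 x (by simpa using (not_le.1 (fun h' => h (by simpa using h'))).le))
  have hK0 : ∀ x, x ∉ Metric.closedBall (0 : EuclideanSpace ℝ (Fin N)) 2 → K x = 0 := fun x hx => by
    have hx' : x ∉ tsupport η := fun h => hx (hts h)
    have hev : η =ᶠ[nhds x] 0 := notMem_tsupport_iff_eventuallyEq.1 hx'
    have e1 : gradDot η η x = 0 := Finset.sum_eq_zero fun i _ => by
      rw [image_eq_zero_of_notMem_tsupport fun h => hx' (tsupport_pd_subset i h), mul_zero]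
    have e2 : lap (fun y => η y ^ 2) x = 0 := by
      rw [lap_pow 2 hη, e1, hev.eq_of_nhds]; simp
    simp only [K, e1, e2]; ring
  obtain ⟨M, hM⟩ := hKc.exists_bound_of_continuous hK
  have hM0 : 0 ≤ M := (norm_nonneg _).trans (hM 0)
  refine ⟨M, hM0, fun w hw hw0 => ?_⟩
  have hw1 : ContDiff ℝ 1 w := hw.of_le (by norm_num)
  have hpow : ∀ b : ℝ, ContDiff ℝ 2 fun y => w y ^ b := fun b =>
    hw.rpow_const_of_ne fun y => (hw0 y).ne'
  have hpow1 : ∀ b : ℝ, ContDiff ℝ 1 fun y => w y ^ b := fun b => (hpow b).of_le (by norm_num)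
  have dw : Differentiable ℝ w := hw.differentiable (by norm_num)
  have dη : Differentiable ℝ η := hη.differentiable (by norm_num)
  have dp : ∀ b : ℝ, Differentiable ℝ fun y => w y ^ b := fun b =>
    (hpow b).differentiable (by norm_num)
  let g : EuclideanSpace ℝ (Fin N) → ℝ := fun y => w y ^ (2 * a - 1) * η y ^ 2
  have hg : ContDiff ℝ 1 g := (hpow1 _).mul (hη1.pow 2)
  have hgc : HasCompactSupport g := hηsc.mul_left
  have i1 := integral_lap_mul hw hg hgc
  have i2 := integral_mul_lap (hpow1 (2 * a)) hηs hηsc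
  have hpt : ∀ x, gradDot (fun y => w y ^ a * η y) (fun y => w y ^ a * η y) x =
      α * gradDot w g x + β * gradDot (fun y => w y ^ (2 * a)) (fun y => η y ^ 2) x
        + w x ^ (2 * a) * gradDot η η x := by
    intro x
    have hwx := hw0 x
    have r1 : w x ^ a * w x ^ a = w x ^ (2 * a) := by rw [← rpow_add hwx]; ring_nf
    have r2 : w x ^ a * w x ^ (a - 1) = w x ^ (2 * a - 1) := by rw [← rpow_add hwx]; ring_nf
    have r3 : w x ^ (a - 1) * w x ^ (a - 1) = w x ^ (2 * a - 1 - 1) := by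
      rw [← rpow_add hwx]; ring_nf
    simp only [g]
    rw [gradDot_mul_left (dp a x) (dη x), gradDot_mul_right (dp a x) (dη x),
      gradDot_mul_right (dp a x) (dη x), gradDot_mul_right (dp _ x) ((dη x).fun_pow 2),
      gradDot_rpow_left a (dw x) hwx, gradDot_rpow_right a (dw x) hwx,
      gradDot_rpow_right a (dw x) hwx, gradDot_rpow_right _ (dw x) hwx,
      gradDot_rpow_left a (dw x) hwx, gradDot_rpow_left _ (dw x) hwx, gradDot_pow_right 2 (dη x),
      gradDot_comm (f := η) (g := w), ← r1, ← r2, ← r3]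
    simp only [Nat.cast_ofNat, Nat.add_one_sub_one, pow_one]
    linear_combination (-(η x ^ 2 * (w x ^ (a - 1)) ^ 2 * gradDot w w x)) * hα
      - (2 * (η x * w x ^ a * w x ^ (a - 1) * gradDot w η x)) * hβ
  have j1 : Integrable fun x => gradDot w g x :=
    (continuous_gradDot hw1 hg).integrable_of_hasCompactSupport hgc.gradDot_right
  have j2 : Integrable fun x => gradDot (fun y => w y ^ (2 * a)) (fun y => η y ^ 2) x :=
    (continuous_gradDot (hpow1 _) (hη1.pow 2)).integrable_of_hasCompactSupport hηsc.gradDot_right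
  have j3 : Integrable fun x => w x ^ (2 * a) * gradDot η η x :=
    ((hpow _).continuous.mul (continuous_gradDot hη1 hη1)).integrable_of_hasCompactSupport
      hηc.gradDot_right.mul_left
  have j4 : Integrable fun x => w x ^ (2 * a) * lap (fun y => η y ^ 2) x :=
    ((hpow _).continuous.mul (continuous_lap hηs)).integrable_of_hasCompactSupport
      hηsc.lap.mul_left
  have hKint : ∫ x, w x ^ (2 * a) * K x ≤ M * ∫ x in Metric.closedBall 0 2, w x ^ (2 * a) := by
    rw [← setIntegral_eq_integral_of_forall_compl_eq_zero
      (s := Metric.closedBall (0 : EuclideanSpace ℝ (Fin N)) 2)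
      (fun x hx => by rw [hK0 x hx, mul_zero]), ← integral_const_mul]
    refine setIntegral_mono_on
      (((hpow _).continuous.mul hK).continuousOn.integrableOn_compact (isCompact_closedBall 0 2))
      ((continuous_const.mul (hpow _).continuous).continuousOn.integrableOn_compact
        (isCompact_closedBall 0 2)) Metric.isClosed_closedBall.measurableSet fun x _ => ?_
    rw [mul_comm]
    exact mul_le_mul_of_nonneg_right ((le_abs_self _).trans (hM x)) (rpow_nonneg (hw0 x).le _)
  have e3 : ∫ x, w x ^ (2 * a) * K x = (∫ x, w x ^ (2 * a) * gradDot η η x) -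
      β * ∫ x, w x ^ (2 * a) * lap (fun y => η y ^ 2) x := by
    rw [← integral_const_mul, ← integral_sub j3 (j4.const_mul β)]
    exact integral_congr_ae (Filter.Eventually.of_forall fun x => by simp only [K]; ring)
  have e4 : ∫ x, w x ^ (2 * a - 1) * (-lap w x) * η x ^ 2 = ∫ x, gradDot w g x := by
    rw [← neg_eq_iff_eq_neg.2 i1, ← integral_neg]
    exact integral_congr_ae (Filter.Eventually.of_forall fun x => by simp only [g]; ring)
  have e5 : ∫ x, gradDot (fun y => w y ^ a * η y) (fun y => w y ^ a * η y) x =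
      α * (∫ x, gradDot w g x) +
        β * (∫ x, gradDot (fun y => w y ^ (2 * a)) (fun y => η y ^ 2) x) +
        ∫ x, w x ^ (2 * a) * gradDot η η x := by
    simp only [hpt]
    have j12 : Integrable fun x => α * gradDot w g x +
        β * gradDot (fun y => w y ^ (2 * a)) (fun y => η y ^ 2) x :=
      (j1.const_mul _).add (j2.const_mul _)
    rw [integral_add j12 j3, integral_add (j1.const_mul _) (j2.const_mul _), integral_const_mul, integral_const_mul]
  rw [e5, e4]
  rw [e3, i2] at hKint
  simp only [α] at *
  linarith

end Bootstrap

section BootstrapStep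

variable {N : ℕ} {p : ℝ} {u : EuclideanSpace ℝ (Fin N) → ℝ}

lemma IsStableSol.first_order (hp : 1 < p) (h : IsStableSol p u)
    {f : EuclideanSpace ℝ (Fin N) → ℝ} (hf : ContDiff ℝ 2 f) (hc : HasCompactSupport f) :
    √p * ∫ x, u x ^ ((p + 1) / 2 - 1) * f x ^ 2 ≤ ∫ x, gradDot f f x := by
  have hp0 : 0 < p := by linarith
  have := first_order_of_second_order (V := fun x => √p * u x ^ ((p + 1) / 2 - 1))
    (continuous_const.mul (h.continuous_rpow _))
    (fun x => mul_pos (sqrt_pos.2 hp0) (rpow_pos_of_pos (h.pos x) _)) (fun φ hφ hφc => ?_) hf hc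
  · rw [← integral_const_mul]
    simpa only [mul_assoc] using this
  · have h1 := h.stable φ hφ hφc
    rw [← integral_const_mul] at h1
    refine le_of_eq_of_le (integral_congr_ae (Filter.Eventually.of_forall fun x => ?_)) h1
    have : (u x ^ ((p + 1) / 2 - 1)) ^ 2 = u x ^ (p - 1) := by
      rw [← rpow_mul_natCast (h.pos x).le]; congr 1; push_cast; ring
    simp only [mul_pow, sq_sqrt hp0.le, this]
    ring

lemma rpow_sub_one_mul_le {s x y : ℝ} (hs : 1 < s) (hx : 0 < x) (hy : 0 < y) :
    x ^ (s - 1) * y ≤ (s - 1) / s * x ^ s + 1 / s * y ^ s := by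
  have hs0 : 0 < s := by linarith
  have := geom_mean_le_arith_mean2_weighted (w₁ := (s - 1) / s) (w₂ := 1 / s) (p₁ := x ^ s)
    (p₂ := y ^ s) (div_nonneg (by linarith) hs0.le) (by positivity) (by positivity) (by positivity)
    (by field_simp; ring)
  rwa [← rpow_mul hx.le, ← rpow_mul hy.le, mul_div_cancel₀ _ hs0.ne', mul_div_cancel₀ _ hs0.ne',
    rpow_one] at this

lemma rpow_sub_one_mul_le_scaled {s x y t : ℝ} (hs : 1 < s) (hx : 0 < x) (hy : 0 < y)
    (ht : 0 < t) :
    x ^ (s - 1) * y ≤ t * ((s - 1) / s * x ^ s + 1 / s * ((t ^ s)⁻¹ * y ^ s)) ∧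
      (t ^ s)⁻¹ * (x * y ^ (s - 1)) ≤
        t⁻¹ * (1 / s * x ^ s + (s - 1) / s * ((t ^ s)⁻¹ * y ^ s)) := by
  obtain ⟨z, rfl⟩ : ∃ z, y = t * z := ⟨y / t, by field_simp⟩
  have hz : 0 < z := (mul_pos_iff_of_pos_left ht).1 hy
  have hts : 0 < t ^ s := rpow_pos_of_pos ht s
  have e : t ^ s = t ^ (s - 1) * t := by rw [← rpow_add_one ht.ne', sub_add_cancel]
  have ht1 : 0 < t ^ (s - 1) := rpow_pos_of_pos ht _
  rw [mul_rpow ht.le hz.le, mul_rpow ht.le hz.le, inv_mul_cancel_left₀ hts.ne']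
  constructor
  · have := mul_le_mul_of_nonneg_left (rpow_sub_one_mul_le hs hx hz) ht.le
    linarith
  · have h1 := mul_le_mul_of_nonneg_left (rpow_sub_one_mul_le hs hz hx) (inv_pos.2 ht).le
    have h2 : (t ^ s)⁻¹ * (x * (t ^ (s - 1) * z ^ (s - 1))) = t⁻¹ * (z ^ (s - 1) * x) := by
      rw [e]; field_simp
    rw [h2]; linarith

/-- The crossed energy estimates for powers of `u` and `-Δu`. -/
lemma exists_bootstrap_bound (N : ℕ) (hp : 1 < p) {s : ℝ} (hs : 1 < s)
    (hA : ((p + 1) / 2 * s) ^ 2 / (4 * ((p + 1) / 2 * s - 1)) * (s ^ 2 / (4 * (s - 1))) < p)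
    {η : EuclideanSpace ℝ (Fin N) → ℝ}
    (hη : ContDiff ℝ 2 η) (hηc : HasCompactSupport η) (hη2 : ∀ x, 2 ≤ ‖x‖ → η x = 0) :
    ∃ C, 0 ≤ C ∧ ∀ u : EuclideanSpace ℝ (Fin N) → ℝ, IsStableSol p u →
      ∫ x, u x ^ ((p + 1) / 2 - 1) * (-lap u x) ^ s * η x ^ 2 ≤
          C * ∫ x in Metric.closedBall 0 2, (-lap u x) ^ s ∧
      ∫ x, gradDot (fun y => (-lap u y) ^ (s / 2) * η y) (fun y => (-lap u y) ^ (s / 2) * η y) x ≤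
          C * ∫ x in Metric.closedBall 0 2, (-lap u x) ^ s := by
  let σ : ℝ := (p + 1) / 2
  let l : ℝ := √(2 / (p + 1))
  have hp0 : 0 < p := by linarith
  have hσ : 1 < σ := by simp only [σ]; linarith
  have hσs : 1 < σ * s := by nlinarith
  have hl : 0 < l := by simp only [l]; positivity
  have hs0 : 0 < s := by linarith
  let A₁ : ℝ := (σ * s) ^ 2 / (4 * (σ * s - 1))
  let A₂ : ℝ := s ^ 2 / (4 * (s - 1))
  have hA₁ : 0 < A₁ := div_pos (by positivity) (by linarith)
  have hA₂ : 0 < A₂ := div_pos (by positivity) (by linarith)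
  have hsp : 0 < √p := sqrt_pos.2 hp0
  let k : ℝ := A₁ / √p
  let m : ℝ := A₂ / √p
  have hk : 0 < k := by positivity
  have hm : 0 < m := by positivity
  let θ : ℝ := √(k * m)
  have hθ1 : θ < 1 := by
    rw [sqrt_lt' one_pos]
    have : k * m = A₁ * A₂ / p := by
      simp only [k, m]; rw [div_mul_div_comm, mul_self_sqrt hp0.le]
    rw [this, one_pow, div_lt_one hp0]; exact hA
  let t : ℝ := √(m / k)
  have ht : 0 < t := sqrt_pos.2 (div_pos hm hk)
  have hkt : k * t = θ := by
    refine (sqrt_eq_iff_mul_self_eq (by positivity) (by positivity)).2 ?_ |>.symm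
    have : t ^ 2 = m / k := sq_sqrt (by positivity)
    calc k * m = k ^ 2 * t ^ 2 := by rw [this]; field_simp
      _ = k * t * (k * t) := by ring
  have hmt : m * t⁻¹ = θ := by
    rw [← hkt, ← div_eq_mul_inv, div_eq_iff ht.ne']
    have : t ^ 2 = m / k := sq_sqrt (by positivity)
    calc m = k * (m / k) := by field_simp
      _ = k * t * t := by rw [← this]; ring
  obtain ⟨M₁, hM₁, h₁⟩ := exists_integral_gradDot_rpow_mul_le hη hηc hη2
    (a := σ * s / 2) (by linarith)
  obtain ⟨M₂, hM₂, h₂⟩ := exists_integral_gradDot_rpow_mul_le hη hηc hη2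
    (a := s / 2) (by linarith)
  let τ : ℝ := (t ^ s)⁻¹
  have hτ : 0 < τ := by positivity
  let C₀ : ℝ := (M₁ * (l ^ s)⁻¹ + τ * M₂) / √p / (1 - θ)
  have h1θ : 0 < 1 - θ := by linarith
  have hC₀ : 0 ≤ C₀ := by positivity
  refine ⟨t ^ s * C₀ + (A₂ * (t ^ s * (t⁻¹ * C₀)) + M₂), by positivity, fun u h => ?_⟩
  have hv0 := h.neg_lap_pos hp
  have hv : ContDiff ℝ 2 fun y => -lap u y := h.lap_contDiff.neg
  have hvpow : ∀ b : ℝ, ContDiff ℝ 2 fun y => (-lap u y) ^ b := fun b =>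
    hv.rpow_const_of_ne fun y => (hv0 y).ne'
  have hupow : ∀ b : ℝ, ContDiff ℝ 2 fun y => u y ^ b := fun b =>
    h.contDiff_two.rpow_const_of_ne fun y => (h.pos y).ne'
  have f₁ := h.first_order hp ((hupow (σ * s / 2)).mul hη) hηc.mul_left
  have f₂ := h.first_order hp ((hvpow (s / 2)).mul hη) hηc.mul_left
  have g₁ := h₁ u h.contDiff_two h.pos
  have g₂ := h₂ _ hv hv0
  set E : ℝ := ∫ x in Metric.closedBall 0 2, (-lap u x) ^ s with hE
  have hE0 : 0 ≤ E := integral_nonneg fun x => rpow_nonneg (hv0 x).le _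
  let F₁ : EuclideanSpace ℝ (Fin N) → ℝ := fun x => u x ^ (σ - 1) * (u x ^ σ) ^ s
  let F₂ : EuclideanSpace ℝ (Fin N) → ℝ := fun x => u x ^ (σ - 1) * (-lap u x) ^ s
  let G₁ : EuclideanSpace ℝ (Fin N) → ℝ := fun x => u x ^ (σ - 1) * ((u x ^ σ) ^ (s - 1) * -lap u x)
  let G₂ : EuclideanSpace ℝ (Fin N) → ℝ := fun x => u x ^ (σ - 1) * (u x ^ σ * (-lap u x) ^ (s - 1))
  have huσ : ∀ b : ℝ, Continuous fun x => (u x ^ σ) ^ b := fun b =>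
    (hupow σ).continuous.rpow_const fun x => Or.inl (rpow_pos_of_pos (h.pos x) σ).ne'
  have iF₁ : Integrable fun x => F₁ x * η x ^ 2 := integrable_mul_pow_cutoff hη.continuous hηc
    ((hupow _).continuous.mul (huσ _)) two_ne_zero
  have iF₂ : Integrable fun x => F₂ x * η x ^ 2 := integrable_mul_pow_cutoff hη.continuous hηc
    ((hupow _).continuous.mul (hvpow _).continuous) two_ne_zero
  have iG₁ : Integrable fun x => G₁ x * η x ^ 2 := integrable_mul_pow_cutoff hη.continuous hηc
    ((hupow _).continuous.mul ((huσ _).mul hv.continuous)) two_ne_zero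
  have iG₂ : Integrable fun x => G₂ x * η x ^ 2 := integrable_mul_pow_cutoff hη.continuous hηc
    ((hupow _).continuous.mul ((hupow _).continuous.mul (hvpow _).continuous)) two_ne_zero
  set I₁ := ∫ x, F₁ x * η x ^ 2 with hI₁
  set I₂ := ∫ x, F₂ x * η x ^ 2 with hI₂
  set J₁ := ∫ x, G₁ x * η x ^ 2 with hJ₁
  set J₂ := ∫ x, G₂ x * η x ^ 2 with hJ₂
  have y₁ : J₁ ≤ (t * ((s - 1) / s)) * I₁ + (t * (1 / s) * τ) * I₂ :=
    integral_le_combo₂ iG₁ iF₁ iF₂ _ _ fun x => by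
      have hx := rpow_pos_of_pos (h.pos x) (σ - 1)
      have := mul_le_mul_of_nonneg_left (rpow_sub_one_mul_le_scaled hs
        (rpow_pos_of_pos (h.pos x) σ) (hv0 x) ht).1 (mul_nonneg hx.le (sq_nonneg (η x)))
      simp only [F₁, F₂, G₁, τ]
      linarith
  have y₂ : τ * J₂ ≤ (t⁻¹ * (1 / s)) * I₁ + (t⁻¹ * ((s - 1) / s) * τ) * I₂ := by
    rw [hJ₂, ← integral_const_mul]
    refine integral_le_combo₂ (iG₂.const_mul τ) iF₁ iF₂ _ _ fun x => ?_
    have hx := rpow_pos_of_pos (h.pos x) (σ - 1)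
    have := mul_le_mul_of_nonneg_left (rpow_sub_one_mul_le_scaled hs
      (rpow_pos_of_pos (h.pos x) σ) (hv0 x) ht).2 (mul_nonneg hx.le (sq_nonneg (η x)))
    simp only [F₁, F₂, G₂, τ]
    linarith
  have eI₁ : ∫ x, u x ^ ((p + 1) / 2 - 1) * (u x ^ (σ * s / 2) * η x) ^ 2 = I₁ :=
    integral_congr_ae (Filter.Eventually.of_forall fun x => by
      have hx := h.pos x
      have : (u x ^ (σ * s / 2)) ^ 2 = (u x ^ σ) ^ s := by
        rw [← rpow_mul_natCast hx.le, ← rpow_mul hx.le]; congr 1; push_cast; ring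
      simp only [F₁, mul_pow, this, σ]; ring)
  have eI₂ : ∫ x, u x ^ ((p + 1) / 2 - 1) * ((-lap u x) ^ (s / 2) * η x) ^ 2 = I₂ :=
    integral_congr_ae (Filter.Eventually.of_forall fun x => by
      have : ((-lap u x) ^ (s / 2)) ^ 2 = (-lap u x) ^ s := by
        rw [← rpow_mul_natCast (hv0 x).le]; congr 1; push_cast; ring
      simp only [F₂, mul_pow, this, σ]; ring)
  have eJ₁ : ∫ x, u x ^ (2 * (σ * s / 2) - 1) * (-lap u x) * η x ^ 2 = J₁ :=
    integral_congr_ae (Filter.Eventually.of_forall fun x => by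
      have hx := h.pos x
      have : u x ^ (2 * (σ * s / 2) - 1) = u x ^ (σ - 1) * (u x ^ σ) ^ (s - 1) := by
        rw [← rpow_mul hx.le, ← rpow_add hx]; congr 1; ring
      simp only [G₁, this]; ring)
  have eJ₂ : ∫ x, (-lap u x) ^ (2 * (s / 2) - 1) * (-lap (fun y => -lap u y) x) * η x ^ 2 = J₂ :=
    integral_congr_ae (Filter.Eventually.of_forall fun x => by
      have hx := h.pos x
      have e1 : u x ^ p = u x ^ (σ - 1) * u x ^ σ := by
        rw [← rpow_add hx]; congr 1; simp only [σ]; ring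
      simp only [G₂, lap_neg, neg_neg, h.lap_lap, e1, mul_div_cancel₀ s two_ne_zero]; ring)
  have eA₁ : (σ * s / 2) ^ 2 / (2 * (σ * s / 2) - 1) = A₁ := by
    simp only [A₁]
    rw [div_eq_div_iff (by linarith) (by linarith)]; ring
  have eA₂ : (s / 2) ^ 2 / (2 * (s / 2) - 1) = A₂ := by
    simp only [A₂]
    rw [div_eq_div_iff (by linarith) (by linarith)]; ring
  have eE : ∫ x in Metric.closedBall 0 2, u x ^ (2 * (σ * s / 2)) ≤ (l ^ s)⁻¹ * E := by
    rw [hE, ← integral_const_mul]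
    refine setIntegral_mono_on
      ((hupow _).continuous.continuousOn.integrableOn_compact (isCompact_closedBall 0 2))
      ((continuous_const.mul (hvpow _).continuous).continuousOn.integrableOn_compact
        (isCompact_closedBall 0 2)) Metric.isClosed_closedBall.measurableSet fun x _ => ?_
    have hx := h.pos x
    have h3 := rpow_le_rpow (by positivity) (h.souplet hp x) hs0.le
    rw [mul_rpow (by positivity) (by positivity), ← rpow_mul hx.le] at h3
    rw [mul_div_cancel₀ _ two_ne_zero, le_inv_mul_iff₀ (by positivity)]
    exact h3
  have eE₂ : ∫ x in Metric.closedBall 0 2, (-lap u x) ^ (2 * (s / 2)) = E := by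
    rw [mul_div_cancel₀ _ two_ne_zero]
  rw [eI₁] at f₁
  rw [eI₂] at f₂
  rw [eA₁, eJ₁] at g₁
  rw [eA₂, eJ₂, eE₂] at g₂
  have k₁ : I₁ ≤ k * J₁ + M₁ * (l ^ s)⁻¹ * E / √p := by
    have := mul_le_mul_of_nonneg_left eE hM₁
    have : √p * I₁ ≤ A₁ * J₁ + M₁ * (l ^ s)⁻¹ * E := by linarith
    simp only [k]
    rw [div_mul_eq_mul_div, ← add_div, le_div_iff₀ hsp]; linarith
  have k₂ : I₂ ≤ m * J₂ + M₂ * E / √p := by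
    have : √p * I₂ ≤ A₂ * J₂ + M₂ * E := by linarith
    simp only [m]
    rw [div_mul_eq_mul_div, ← add_div, le_div_iff₀ hsp]; linarith
  have hss : (s - 1) / s + 1 / s = 1 := by field_simp; ring
  have hsum : I₁ + τ * I₂ ≤ C₀ * E := by
    have a₁ := mul_le_mul_of_nonneg_left y₁ hk.le
    have a₂ := mul_le_mul_of_nonneg_left y₂ hm.le
    have a₃ := mul_le_mul_of_nonneg_left k₂ hτ.le
    have b₁ : k * (t * ((s - 1) / s) * I₁ + t * (1 / s) * τ * I₂) +
        m * (t⁻¹ * (1 / s) * I₁ + t⁻¹ * ((s - 1) / s) * τ * I₂) = θ * (I₁ + τ * I₂) := by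
      linear_combination ((s - 1) / s * I₁ + 1 / s * τ * I₂) * hkt +
        (1 / s * I₁ + (s - 1) / s * τ * I₂) * hmt + θ * (I₁ + τ * I₂) * hss
    have b₂ : C₀ * E = ((M₁ * (l ^ s)⁻¹ * E / √p + τ * (M₂ * E / √p))) / (1 - θ) := by
      simp only [C₀]; ring
    rw [b₂, le_div_iff₀ h1θ]
    linarith
  have hI₁0 : 0 ≤ I₁ := integral_nonneg fun x => by
    have := h.pos x
    simp only [F₁]; positivity
  have hI₂0 : 0 ≤ I₂ := integral_nonneg fun x => by
    have := h.pos x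
    have := hv0 x
    simp only [F₂]; positivity
  have hts : 0 < t ^ s := by positivity
  have c₁ : I₂ ≤ t ^ s * C₀ * E := by
    have h4 : τ * I₂ ≤ C₀ * E := by linarith
    simp only [τ] at h4
    rw [inv_mul_le_iff₀ hts] at h4
    linarith
  have c₂ : J₂ ≤ t ^ s * (t⁻¹ * C₀) * E := by
    have ht' := inv_pos.2 ht
    have h1 : 1 / s ≤ 1 := by
      rw [div_le_one hs0]; exact hs.le
    have h2 : (s - 1) / s ≤ 1 := by
      rw [div_le_one hs0]; linarith
    have h3 : τ * J₂ ≤ t⁻¹ * (I₁ + τ * I₂) := by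
      have d₁ := mul_le_mul_of_nonneg_left h1 (mul_nonneg ht'.le hI₁0)
      have d₂ := mul_le_mul_of_nonneg_left h2 (mul_nonneg ht'.le (mul_nonneg hτ.le hI₂0))
      linarith
    have h4 : τ * J₂ ≤ t⁻¹ * (C₀ * E) := h3.trans (mul_le_mul_of_nonneg_left hsum ht'.le)
    simp only [τ] at h4
    rw [inv_mul_le_iff₀ hts] at h4
    linarith
  have z₁ : 0 ≤ t ^ s * C₀ * E := by positivity
  have z₂ : 0 ≤ A₂ * (t ^ s * (t⁻¹ * C₀)) * E := by positivity
  have z₃ : 0 ≤ M₂ * E := by positivity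
  have c₃ := mul_le_mul_of_nonneg_left c₂ hA₂.le
  constructor
  · linarith
  · linarith

end BootstrapStep

section Sobolev

open scoped NNReal ENNReal

variable {N : ℕ} {p : ℝ}

lemma norm_fderiv_sq_le {f : EuclideanSpace ℝ (Fin N) → ℝ} (x : EuclideanSpace ℝ (Fin N)) :
    ‖fderiv ℝ f x‖ ^ 2 ≤ gradDot f f x := by
  have h0 := gradDot_self_nonneg (f := f) (x := x)
  refine (Real.le_sqrt (norm_nonneg _) h0).1 ?_
  refine ContinuousLinearMap.opNorm_le_bound _ (sqrt_nonneg _) fun y => ?_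
  rw [Real.norm_eq_abs, ← sqrt_sq (norm_nonneg y), ← sqrt_mul h0, EuclideanSpace.real_norm_sq_eq]
  refine abs_le_sqrt ?_
  rw [clm_apply_eq_sum, mul_comm]
  refine (Finset.sum_mul_sq_le_sq_mul_sq _ _ _).trans (le_of_eq ?_)
  simp only [gradDot, sq, pd]

/-- The Sobolev inequality on `ℝ^N`. -/
lemma exists_sobolev (hN : 3 ≤ N) : ∃ C, 0 ≤ C ∧ ∀ f : EuclideanSpace ℝ (Fin N) → ℝ,
    ContDiff ℝ 1 f → HasCompactSupport f →
      ∫ x, |f x| ^ (2 * N / (N - 2) : ℝ) ≤ C * (∫ x, gradDot f f x) ^ (N / (N - 2) : ℝ) := by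
  have hN' : (3 : ℝ) ≤ N := by exact_mod_cast hN
  have hq : (0 : ℝ) < 2 * N / (N - 2) := div_pos (by linarith) (by linarith)
  let q : ℝ≥0 := ⟨2 * N / (N - 2), hq.le⟩
  let K : ℝ≥0 := SNormLESNormFDerivOfEqConst ℝ (volume : Measure (EuclideanSpace ℝ (Fin N))) (2 : ℝ≥0)
  have hqv : (q : ℝ) = 2 * N / (N - 2) := rfl
  refine ⟨(K : ℝ) ^ (2 * N / (N - 2) : ℝ), by positivity, fun f hf hc => ?_⟩
  have h := eLpNorm_le_eLpNorm_fderiv_of_eq (volume : Measure (EuclideanSpace ℝ (Fin N))) hf hc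
    (p := 2) (p' := q) (by norm_num) (by simp; omega)
    (by rw [hqv, finrank_euclideanSpace_fin, NNReal.coe_inv, NNReal.coe_ofNat]
        have : (N : ℝ) - 2 ≠ 0 := by linarith
        field_simp)
  have hm₁ : MemLp f q := hf.continuous.memLp_of_hasCompactSupport hc
  have hf' := hf.continuous_fderiv (by norm_num)
  have hm₂ : MemLp (fderiv ℝ f) (2 : ℝ≥0) := hf'.memLp_of_hasCompactSupport (hc.fderiv ℝ)
  have hq0 : (q : ℝ≥0∞) ≠ 0 := by
    rw [ENNReal.coe_ne_zero]
    exact fun h0 => hq.ne' (congrArg NNReal.toReal h0)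
  change _ ≤ (K : ℝ≥0∞) * _ at h
  rw [hm₁.eLpNorm_eq_integral_rpow_norm hq0 ENNReal.coe_ne_top,
    hm₂.eLpNorm_eq_integral_rpow_norm (by norm_num) ENNReal.coe_ne_top,
    ← ENNReal.ofReal_coe_nnreal (p := K), ← ENNReal.ofReal_mul NNReal.zero_le_coe,
    ENNReal.ofReal_le_ofReal_iff (by positivity)] at h
  simp only [ENNReal.coe_toReal, NNReal.coe_ofNat, Real.norm_eq_abs] at h
  change (∫ x, |f x| ^ (2 * N / (N - 2) : ℝ)) ^ (2 * N / (N - 2) : ℝ)⁻¹ ≤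
    (K : ℝ) * (∫ x, ‖fderiv ℝ f x‖ ^ (2 : ℝ)) ^ (2 : ℝ)⁻¹ at h
  have hI : 0 ≤ ∫ x, |f x| ^ (2 * N / (N - 2) : ℝ) := by positivity
  have hD : 0 ≤ ∫ x, ‖fderiv ℝ f x‖ ^ (2 : ℝ) := by positivity
  have hle : ∫ x, ‖fderiv ℝ f x‖ ^ (2 : ℝ) ≤ ∫ x, gradDot f f x := by
    refine integral_mono ?_ ((continuous_gradDot hf hf).integrable_of_hasCompactSupport
      hc.gradDot_right) fun x => ?_
    · simpa using hm₂.integrable_norm_rpow (by norm_num) ENNReal.coe_ne_top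
    · simpa using norm_fderiv_sq_le x
  have h2 := rpow_le_rpow (by positivity) h hq.le
  rw [← rpow_mul hI, inv_mul_cancel₀ hq.ne', rpow_one, mul_rpow (NNReal.coe_nonneg K) (by positivity),
    ← rpow_mul hD, show (2 : ℝ)⁻¹ * (2 * N / (N - 2)) = N / (N - 2) by ring] at h2
  refine h2.trans (mul_le_mul_of_nonneg_left ?_ (by positivity))
  exact rpow_le_rpow hD hle (div_nonneg (by linarith) (by linarith))

lemma setIntegral_closedBall_comp_smul (F : EuclideanSpace ℝ (Fin N) → ℝ) {R : ℝ} (hR : 0 < R) :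
    ∫ x in Metric.closedBall 0 1, F (R • x) =
      (R ^ N)⁻¹ * ∫ x in Metric.closedBall 0 R, F x := by
  rw [← integral_indicator Metric.isClosed_closedBall.measurableSet,
    ← integral_indicator Metric.isClosed_closedBall.measurableSet]
  have := integral_comp_affine ((Metric.closedBall 0 R).indicator F) 0 hR
  rw [← this]
  refine integral_congr_ae (Filter.Eventually.of_forall fun x => ?_)
  simp only [zero_add]
  have : R • x ∈ Metric.closedBall (0 : EuclideanSpace ℝ (Fin N)) R ↔
      x ∈ Metric.closedBall (0 : EuclideanSpace ℝ (Fin N)) 1 := by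
    simp [norm_smul, abs_of_pos hR, hR]
  by_cases hx : x ∈ Metric.closedBall (0 : EuclideanSpace ℝ (Fin N)) 1
  · simp only [Set.indicator_of_mem hx, Set.indicator_of_mem (this.2 hx)]
  · simp only [Set.indicator_of_notMem hx, Set.indicator_of_notMem (mt this.1 hx)]

/-- A uniform bound for the `L^s` norm of `Δu` on the unit ball over all stable solutions. -/
def LapBound (N : ℕ) (p s : ℝ) : Prop :=
  ∃ C, ∀ u : EuclideanSpace ℝ (Fin N) → ℝ, IsStableSol p u →
    ∫ x in Metric.closedBall 0 1, (-lap u x) ^ s ≤ C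

lemma IsStableSol.continuous_neg_lap_rpow {u : EuclideanSpace ℝ (Fin N) → ℝ} (hp : 1 < p)
    (h : IsStableSol p u) (s : ℝ) : Continuous fun x => (-lap u x) ^ s :=
  h.lap_contDiff.continuous.neg.rpow_const fun x => Or.inl (h.neg_lap_pos hp x).ne'

lemma LapBound.closedBall_two {s : ℝ} (hp : 1 < p) (h : LapBound N p s) :
    ∃ C, ∀ u : EuclideanSpace ℝ (Fin N) → ℝ, IsStableSol p u →
      ∫ x in Metric.closedBall 0 2, (-lap u x) ^ s ≤ C := by
  obtain ⟨C, hC⟩ := h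
  let c : ℝ := (2 : ℝ) ^ (4 / (p - 1)) * 2 ^ 2
  refine ⟨2 ^ N * ((c ^ s)⁻¹ * C), fun u hu => ?_⟩
  have h1 := hC _ (hu.rescale hp 0 two_pos)
  have e : ∀ x, (-lap (rescale p u 0 2) x) ^ s = c ^ s * (-lap u ((2 : ℝ) • x)) ^ s := fun x => by
    rw [lap_rescale hu.contDiff_two, ← mul_neg, mul_rpow (by positivity)
      (hu.neg_lap_pos hp _).le, zero_add]
  simp only [e, integral_const_mul] at h1
  rw [setIntegral_closedBall_comp_smul (fun x => (-lap u x) ^ s) two_pos] at h1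
  rw [← le_inv_mul_iff₀ (by positivity), inv_mul_le_iff₀ (by positivity)] at h1
  exact h1

lemma LapBound.mono {s s' : ℝ} (hp : 1 < p) (hs : 0 ≤ s) (hss : s ≤ s') (h : LapBound N p s') :
    LapBound N p s := by
  obtain ⟨C, hC⟩ := h
  refine ⟨(∫ _ in Metric.closedBall (0 : EuclideanSpace ℝ (Fin N)) 1, (1 : ℝ)) + C,
    fun u hu => ?_⟩
  have i := fun s => (hu.continuous_neg_lap_rpow hp s).continuousOn.integrableOn_compact
    (μ := volume) (isCompact_closedBall (0 : EuclideanSpace ℝ (Fin N)) 1)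
  have i2 : IntegrableOn (fun _ => (1 : ℝ)) (Metric.closedBall (0 : EuclideanSpace ℝ (Fin N)) 1) :=
    continuousOn_const.integrableOn_compact (isCompact_closedBall 0 1)
  have := integral_le_combo₂ (i s) i2 (i s') 1 1 fun x => by
    have hv := hu.neg_lap_pos hp x
    rw [one_mul, one_mul]
    rcases le_total (-lap u x) 1 with h1 | h1
    · linarith [rpow_le_one hv.le h1 hs, rpow_nonneg hv.le s']
    · linarith [rpow_le_rpow_of_exponent_le h1 hss]
  rw [one_mul, one_mul] at this
  exact this.trans (add_le_add le_rfl (hC u hu))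

lemma lapBound_two (hp : 1 < p) : LapBound N p 2 := by
  obtain ⟨C, hC⟩ := energy_estimate N hp
  exact ⟨C, fun u hu => by simpa using hC u hu⟩

lemma LapBound.step (hN : 3 ≤ N) (hp : 1 < p) {s : ℝ} (hs : 1 < s)
    (hA : ((p + 1) / 2 * s) ^ 2 / (4 * ((p + 1) / 2 * s - 1)) * (s ^ 2 / (4 * (s - 1))) < p)
    (h : LapBound N p s) : LapBound N p (s * (N / (N - 2))) := by
  have hN' : (3 : ℝ) ≤ N := by exact_mod_cast hN
  have hr : (0 : ℝ) ≤ N / (N - 2) := div_nonneg (by linarith) (by linarith)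
  obtain ⟨η, hη, hηc, -, -, hη1, hη2⟩ := exists_cutoff N
  have hη' : ContDiff ℝ 2 η := contDiff_infty.1 hη 2
  obtain ⟨C₁, hC₁, h₁⟩ := exists_bootstrap_bound N hp hs hA hη' hηc hη2
  obtain ⟨C₂, hC₂, h₂⟩ := exists_sobolev hN
  obtain ⟨C₃, h₃⟩ := h.closedBall_two hp
  refine ⟨C₂ * (C₁ * C₃) ^ (N / (N - 2) : ℝ), fun u hu => ?_⟩
  have hv := hu.neg_lap_pos hp
  have hvs : ContDiff ℝ 2 fun y => (-lap u y) ^ (s / 2) :=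
    hu.lap_contDiff.neg.rpow_const_of_ne fun y => (hv y).ne'
  have hf : ContDiff ℝ 1 fun y => (-lap u y) ^ (s / 2) * η y :=
    (hvs.mul hη').of_le (by norm_num)
  have hq : (0 : ℝ) < 2 * N / (N - 2) := div_pos (by linarith) (by linarith)
  have k := h₂ _ hf hηc.mul_left
  have k₁ := ((h₁ u hu).2.trans (mul_le_mul_of_nonneg_left (h₃ u hu) hC₁))
  have k₂ := k.trans (mul_le_mul_of_nonneg_left (rpow_le_rpow
    (integral_nonneg fun x => gradDot_self_nonneg) k₁ hr) hC₂)
  refine le_trans ?_ k₂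
  have hint : Integrable fun x => |(-lap u x) ^ (s / 2) * η x| ^ (2 * N / (N - 2) : ℝ) := by
    refine (hf.continuous.abs.rpow_const fun x => Or.inr hq.le).integrable_of_hasCompactSupport ?_
    refine HasCompactSupport.intro hηc.isCompact fun x hx => ?_
    rw [image_eq_zero_of_notMem_tsupport hx, mul_zero, abs_zero, zero_rpow hq.ne']
  refine le_trans ?_ (setIntegral_le_integral (s := Metric.closedBall 0 1) hint
    (ae_of_all _ fun x => rpow_nonneg (abs_nonneg _) _))
  refine setIntegral_mono_on ((hu.continuous_neg_lap_rpow hp _).continuousOn.integrableOn_compact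
    (isCompact_closedBall 0 1)) hint.integrableOn Metric.isClosed_closedBall.measurableSet
    fun x hx => ?_
  rw [hη1 x (by simpa using hx), mul_one, abs_of_pos (rpow_pos_of_pos (hv x) _),
    ← rpow_mul (hv x).le]
  exact le_of_eq (by congr 1; ring)

lemma lapBound_of_forall (hN : 3 ≤ N) (hp : 1 < p) {s : ℝ} (hs : 2 ≤ s)
    (hA : ∀ r ∈ Set.Icc 2 s, ((p + 1) / 2 * r) ^ 2 / (4 * ((p + 1) / 2 * r - 1)) *
      (r ^ 2 / (4 * (r - 1))) < p) : LapBound N p s := by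
  have hN' : (3 : ℝ) ≤ N := by exact_mod_cast hN
  let r : ℝ := N / (N - 2)
  have hr : 1 < r := by
    simp only [r]; rw [one_lt_div (by linarith)]; linarith
  have key : ∀ k : ℕ, LapBound N p (min s (2 * r ^ k)) := by
    intro k
    induction k with
    | zero => simpa [hs] using lapBound_two hp
    | succ k ih =>
      have hk : 1 ≤ r ^ k := one_le_pow₀ hr.le
      have h2 : 2 ≤ min s (2 * r ^ k) := le_min hs (by linarith)
      refine (ih.step hN hp (by linarith) (hA _ ⟨h2, min_le_left _ _⟩)).mono hp ?_ ?_
      · exact le_min (by linarith) (by positivity)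
      · rw [min_mul_of_nonneg _ _ (by positivity), pow_succ, ← mul_assoc]
        exact min_le_min_right _ (by nlinarith)
  obtain ⟨k, hk⟩ := pow_unbounded_of_one_lt s hr
  have := key k
  rwa [min_eq_left (by linarith)] at this

end Sobolev

section Conclusion

variable {N : ℕ} {p : ℝ}

lemma Hpoly_scale (hp : 1 < p) (s : ℝ) :
    Hpoly p ((p + 1) / (p - 1) * s) = ((p + 1) / (p - 1)) ^ 4 *
      (s ^ 4 - 32 * p / (p + 1) * s ^ 2 + 32 * p * (p + 3) / (p + 1) ^ 2 * s
        - 64 * p / (p + 1) ^ 2) := by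
  have h1 : p - 1 ≠ 0 := by linarith
  have h2 : p + 1 ≠ 0 := by linarith
  unfold Hpoly
  field_simp

/-- Signs of the rescaled quartic between `2` and its largest root. -/
lemma quartic_neg (hp : 1 < p) {s₀ : ℝ} {q : ℝ → ℝ}
    (hq : ∀ s, q s = s ^ 4 - 32 * p / (p + 1) * s ^ 2 + 32 * p * (p + 3) / (p + 1) ^ 2 * s
        - 64 * p / (p + 1) ^ 2)
    (hroot : q s₀ = 0) (hmax : ∀ s, s₀ < s → q s ≠ 0) :
    2 < s₀ ∧ ∀ r, 2 ≤ r → r < s₀ → q r < 0 := by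
  have hp1 : p + 1 ≠ 0 := by linarith
  obtain ⟨a, ha⟩ : ∃ a, a = 32 * p / (p + 1) := ⟨_, rfl⟩
  obtain ⟨b, hb⟩ : ∃ b, b = 32 * p * (p + 3) / (p + 1) ^ 2 := ⟨_, rfl⟩
  obtain ⟨d, hd⟩ : ∃ d, d = 64 * p / (p + 1) ^ 2 := ⟨_, rfl⟩
  have ha0 : 0 < a := by rw [ha]; exact div_pos (by linarith) (by linarith)
  have hb0 : 0 < b := by
    rw [hb]; exact div_pos (mul_pos (by linarith) (by linarith)) (by positivity)
  have hbd : d < b := by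
    rw [hb, hd]
    exact div_lt_div_of_pos_right (by nlinarith) (by positivity)
  simp only [← ha, ← hb, ← hd] at hq
  have q1 : q 1 = 1 := by
    rw [hq, ha, hb, hd]; field_simp; ring
  have q2 : q 2 < 0 := by
    have e : q 2 = 16 * (1 - p) * (3 * p + 1) / (p + 1) ^ 2 := by
      rw [hq, ha, hb, hd]; field_simp; ring
    rw [e]
    exact div_neg_of_neg_of_pos (by nlinarith) (by positivity)
  have qbig : 0 < q (a + 2) := by
    rw [hq]
    nlinarith [mul_pos ha0 hb0, mul_pos ha0 ha0, mul_pos (mul_pos ha0 ha0) ha0, sq_nonneg (a * a)]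
  have hcont : Continuous q := by
    rw [show q = fun s => s ^ 4 - a * s ^ 2 + b * s - d from funext hq]; fun_prop
  have hs₀ : 2 < s₀ := by
    obtain ⟨r, hr, hr0⟩ := intermediate_value_Ioo (by linarith : (2 : ℝ) ≤ a + 2)
      hcont.continuousOn ⟨q2, qbig⟩
    by_contra hle
    exact hmax r (by linarith [hr.1]) hr0
  refine ⟨hs₀, fun r hr hrs => ?_⟩
  let Q : ℝ → ℝ := fun s => s ^ 3 + s₀ * s ^ 2 + (s₀ ^ 2 - a) * s + (s₀ ^ 3 - a * s₀ + b)
  have hfac : ∀ s, q s = (s - s₀) * Q s := fun s => by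
    have := hq s₀
    rw [hroot] at this
    rw [hq]; simp only [Q]
    linear_combination (-1 : ℝ) * this
  have hQ1 : Q 1 < 0 := by
    rw [hfac] at q1
    by_contra hneg
    push Not at hneg
    nlinarith
  have hQ2 : 0 < Q 2 := by
    rw [hfac] at q2
    by_contra hneg
    push Not at hneg
    nlinarith
  have hconv : Q r = (r - 1) * Q 2 - (r - 2) * Q 1 + (r - 1) * (r - 2) * (r + 3 + s₀) := by
    simp only [Q]; ring
  have hQr : 0 < Q r := by
    have t1 : 0 < (r - 1) * Q 2 := mul_pos (by linarith) hQ2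
    have t2 : 0 ≤ (r - 2) * -Q 1 := mul_nonneg (by linarith) (by linarith)
    have t3 : 0 ≤ (r - 1) * (r - 2) * (r + 3 + s₀) :=
      mul_nonneg (mul_nonneg (by linarith) (by linarith)) (by linarith)
    linarith
  rw [hfac]
  exact mul_neg_of_neg_of_pos (by linarith) hQr

lemma coefficient_lt_of_quartic_neg (hp : 1 < p) {s : ℝ} (hs : 1 < s)
    (h : s ^ 4 - 32 * p / (p + 1) * s ^ 2 + 32 * p * (p + 3) / (p + 1) ^ 2 * s
        - 64 * p / (p + 1) ^ 2 < 0) :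
    ((p + 1) / 2 * s) ^ 2 / (4 * ((p + 1) / 2 * s - 1)) * (s ^ 2 / (4 * (s - 1))) < p := by
  have hp1 : p + 1 ≠ 0 := by linarith
  have h1 : 0 < (p + 1) / 2 * s - 1 := by nlinarith
  have h2 : 0 < s - 1 := by linarith
  rw [div_mul_div_comm, div_lt_iff₀ (by positivity)]
  have h3 := mul_neg_of_neg_of_pos h (by positivity : 0 < ((p + 1) / 2) ^ 2)
  have e : (s ^ 4 - 32 * p / (p + 1) * s ^ 2 + 32 * p * (p + 3) / (p + 1) ^ 2 * s
        - 64 * p / (p + 1) ^ 2) * ((p + 1) / 2) ^ 2 = ((p + 1) / 2 * s) ^ 2 * s ^ 2 -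
        p * (4 * ((p + 1) / 2 * s - 1) * (4 * (s - 1))) := by
    field_simp; ring
  linarith

/-- Nonexistence of stable solutions below the dimension attached to an admissible exponent. -/
lemma not_isStableSol (hN : 3 ≤ N) (hp : 1 < p) {s : ℝ} (hs : 2 ≤ s)
    (hA : ∀ r ∈ Set.Icc 2 s, ((p + 1) / 2 * r) ^ 2 / (4 * ((p + 1) / 2 * r - 1)) *
      (r ^ 2 / (4 * (r - 1))) < p) (hdim : (N : ℝ) < 2 + 2 * ((p + 1) / (p - 1) * s))
    {u : EuclideanSpace ℝ (Fin N) → ℝ} (hu : IsStableSol p u) : False := by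
  have hp' : 0 < p - 1 := by linarith
  obtain ⟨η, hη, hηc, -, -, hη1, hη2⟩ := exists_cutoff N
  have hη' : ContDiff ℝ 2 η := contDiff_infty.1 hη 2
  obtain ⟨C₁, hC₁, h₁⟩ := exists_bootstrap_bound N hp (by linarith)
    (hA s (Set.right_mem_Icc.2 hs)) hη' hηc hη2
  obtain ⟨C₂, h₂⟩ := (lapBound_of_forall hN hp hs hA).closedBall_two hp
  let F : (EuclideanSpace ℝ (Fin N) → ℝ) → EuclideanSpace ℝ (Fin N) → ℝ := fun w x =>
    w x ^ ((p + 1) / 2 - 1) * (-lap w x) ^ s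
  have hFc : ∀ w, IsStableSol p w → Continuous (F w) := fun w hw =>
    (hw.continuous_rpow _).mul (hw.continuous_neg_lap_rpow hp s)
  have hF0 : ∀ w, IsStableSol p w → ∀ x, 0 < F w x := fun w hw x =>
    mul_pos (rpow_pos_of_pos (hw.pos x) _) (rpow_pos_of_pos (hw.neg_lap_pos hp x) _)
  have key : ∀ w, IsStableSol p w → ∫ x in Metric.closedBall 0 1, F w x ≤ C₁ * C₂ := by
    intro w hw
    refine le_trans ?_ ((h₁ w hw).1.trans (mul_le_mul_of_nonneg_left (h₂ w hw) hC₁))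
    have hint := integrable_mul_pow_cutoff hη'.continuous hηc (hFc w hw) two_ne_zero
    refine le_trans ?_ (setIntegral_le_integral (s := Metric.closedBall 0 1) hint
      (ae_of_all _ fun x => mul_nonneg (hF0 w hw x).le (sq_nonneg _)))
    refine setIntegral_mono_on ((hFc w hw).continuousOn.integrableOn_compact
      (isCompact_closedBall 0 1)) hint.integrableOn Metric.isClosed_closedBall.measurableSet
      fun x hx => ?_
    rw [hη1 x (by simpa using hx), one_pow, mul_one]
  have hI : 0 < ∫ x in Metric.closedBall 0 1, F u x := by
    rw [setIntegral_pos_iff_support_of_nonneg_ae (ae_of_all _ fun x => (hF0 u hu x).le)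
      ((hFc u hu).continuousOn.integrableOn_compact (isCompact_closedBall 0 1))]
    have : Function.support (F u) = Set.univ :=
      Set.eq_univ_of_forall fun x => (hF0 u hu x).ne'
    rw [this, Set.univ_inter]
    exact Metric.measure_closedBall_pos _ _ one_pos
  let e : ℝ := 2 + 2 * ((p + 1) / (p - 1) * s) - N
  have he : 0 < e := by simp only [e]; linarith
  have hscale : ∀ R : ℝ, 1 ≤ R → R ^ e * ∫ x in Metric.closedBall 0 1, F u x ≤ C₁ * C₂ := by
    intro R hR
    have hR0 : 0 < R := by linarith
    have k := key _ (hu.rescale hp 0 hR0)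
    have eF : ∀ x, F (rescale p u 0 R) x = R ^ (e + N) * F u (R • x) := fun x => by
      simp only [F]
      rw [lap_rescale hu.contDiff_two, ← mul_neg, zero_add, rescale, zero_add,
        mul_rpow (by positivity) (hu.pos _).le, mul_rpow (by positivity)
        (hu.neg_lap_pos hp _).le, ← rpow_mul hR0.le, ← rpow_natCast R 2, ← rpow_add hR0,
        ← rpow_mul hR0.le]
      have : R ^ (e + N) = R ^ (4 / (p - 1) * ((p + 1) / 2 - 1)) *
          R ^ ((4 / (p - 1) + (2 : ℕ)) * s) := by
        rw [← rpow_add hR0]; congr 1; simp only [e]; push_cast; field_simp; ring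
      rw [this]; ring
    simp only [eF, integral_const_mul] at k
    rw [setIntegral_closedBall_comp_smul (F u) hR0, rpow_add hR0, rpow_natCast, mul_assoc,
      mul_inv_cancel_left₀ (by positivity)] at k
    refine le_trans (mul_le_mul_of_nonneg_left ?_ (by positivity)) k
    exact setIntegral_mono_set ((hFc u hu).continuousOn.integrableOn_compact
      (isCompact_closedBall 0 R)) (ae_of_all _ fun x => (hF0 u hu x).le)
      (Metric.closedBall_subset_closedBall hR).eventuallyLE
  obtain ⟨R, hR1, hR2⟩ := ((Filter.eventually_ge_atTop (1 : ℝ)).and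
    ((tendsto_rpow_atTop he).eventually_gt_atTop
      (C₁ * C₂ / ∫ x in Metric.closedBall 0 1, F u x))).exists
  rw [div_lt_iff₀ hI] at hR2
  linarith [hscale R hR1]

end Conclusion

/-- If `N < 2 + 2x₀`, with `x₀` the largest real root of `H`, then there is no classical
stable solution of `Δ²u = u^p`, `u > 0` in `ℝ^N`. -/
theorem no_stable_solution_of_dim_lt
    (N : ℕ) (hN : 5 ≤ N) (p : ℝ) (hp : 1 < p) (x₀ : ℝ)
    (hroot : Hpoly p x₀ = 0) (hlargest : ∀ x : ℝ, x₀ < x → Hpoly p x ≠ 0)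
    (hdim : (N : ℝ) < 2 + 2 * x₀) :
    ¬ ∃ u : EuclideanSpace ℝ (Fin N) → ℝ,
        ContDiff ℝ 4 u ∧ (∀ x, 0 < u x) ∧
        (∀ x, lap (lap u) x = u x ^ p) ∧
        (∀ φ : EuclideanSpace ℝ (Fin N) → ℝ, ContDiff ℝ (⊤ : ℕ∞) φ →
          HasCompactSupport φ →
          p * ∫ x, u x ^ (p - 1) * φ x ^ 2 ≤ ∫ x, (lap φ x) ^ 2) := by
  rintro ⟨u, hu1, hu2, hu3, hu4⟩
  have hu : IsStableSol p u := ⟨hu1, hu2, hu3, hu4⟩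
  let c : ℝ := (p + 1) / (p - 1)
  have hc : 0 < c := div_pos (by linarith) (by linarith)
  obtain ⟨s₀, rfl⟩ : ∃ s₀, x₀ = c * s₀ := ⟨x₀ / c, by field_simp⟩
  have hscale := Hpoly_scale hp
  obtain ⟨hs₀, hneg⟩ := quartic_neg hp (fun _ => rfl)
    (by
      rw [hscale] at hroot
      exact (mul_eq_zero.1 hroot).resolve_left (pow_pos hc 4).ne')
    (fun s hs h0 => hlargest (c * s) (mul_lt_mul_of_pos_left hs hc) (by
      rw [hscale, h0, mul_zero]))
  obtain ⟨s, hs1, hs2⟩ := exists_between (max_lt hs₀ (show ((N : ℝ) - 2) / 2 / c < s₀ by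
    rw [div_lt_iff₀ hc]; linarith))
  have hs3 := (le_max_right _ _).trans_lt hs1
  have hs4 := (le_max_left _ _).trans_lt hs1
  rw [div_lt_iff₀ hc] at hs3
  exact not_isStableSol (by omega) hp hs4.le (fun r hr => coefficient_lt_of_quartic_neg hp
    (by linarith [hr.1]) (hneg r hr.1 (hr.2.trans_lt hs2))) (by simp only [c] at hs3; linarith) hu
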